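/- Assume Σ = I_N (so that C_min = C_max = γ = θ_u = 1 and φ_N = λ²/(8η² ln(N) m)), and assume: (ai') m(1/(1+ε) − 6/φ_N) > 12 s ln(N−s) for some ε ∈ (0,1/2) with ε > 8√(s/m), and (aii') g(λ) < min_{j∈S}|v_j| where g(λ) := c₃λ/(2m) + 20√(η² ln(s)/m) with c₃ the universal constant from Wainwright's support recovery theorem. Then there exist absolute constants 𝐜₁, 𝐜₂ > 0 such that ℙ( C_UL(y,A) ≥ K̂ ) ≤ 𝐜₁ e^{−𝐜₂ min{ln(N−s), s}}, where σ̂ := min{ 1/(4(√s + √m)⁴), λ/4, min_{j∈S}|v_j| − g(λ) }, α̂ := max{ 1, (5/2)√m(η + ‖v‖₂), 3√m + 6√N } and K̂ := (mN)^{1/2} max{ q(α̂,σ̂)/σ̂², 6α̂/√σ̂, 1 }. -/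

import Mathlib

open MeasureTheory ProbabilityTheory Filter Real Set
open scoped ENNReal NNReal

noncomputable section

/-- The LASSO objective function `‖Ax - y‖₂² + λ‖x‖₁`. -/
def lassoObj {m N : ℕ} (lam : ℝ) (y : Fin m → ℝ) (A : Matrix (Fin m) (Fin N) ℝ)
    (x : Fin N → ℝ) : ℝ :=
  (∑ i, (A.mulVec x i - y i) ^ 2) + lam * ∑ j, |x j|

/-- The LASSO solution set `Sol(y,A)`. -/
def Sol {m N : ℕ} (lam : ℝ) (y : Fin m → ℝ) (A : Matrix (Fin m) (Fin N) ℝ) :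
    Set (Fin N → ℝ) :=
  {x | ∀ z, lassoObj lam y A x ≤ lassoObj lam y A z}

/-- Support of a vector. -/
def supp {N : ℕ} (x : Fin N → ℝ) : Set (Fin N) := {i | x i ≠ 0}

/-- Stability support: distance to support change. -/
def stsp {m N : ℕ} (lam : ℝ) (y : Fin m → ℝ) (A : Matrix (Fin m) (Fin N) ℝ) : ℝ :=
  sInf {δ : ℝ | 0 ≤ δ ∧ ∃ (y' : Fin m → ℝ) (A' : Matrix (Fin m) (Fin N) ℝ)
    (x x' : Fin N → ℝ), x ∈ Sol lam y A ∧ x' ∈ Sol lam y' A' ∧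
    (∀ i, |y' i - y i| ≤ δ) ∧ (∀ i j, |A' i j - A i j| ≤ δ) ∧ supp x ≠ supp x'}

/-- The LASSO condition number `C_UL(y,A)`; it is `∞` when `stsp(y,A) = 0`. -/
def condUL {m N : ℕ} (lam : ℝ) (y : Fin m → ℝ) (A : Matrix (Fin m) (Fin N) ℝ) : ℝ≥0∞ :=
  if stsp lam y A = 0 then ⊤ else ENNReal.ofReal (1 / stsp lam y A)

/-- `m = 1` case: identify `ℝ^{1×N}` with `ℝ^N` and `ℝ^1` with `ℝ`. -/
def Sol1 {N : ℕ} (lam : ℝ) (y : ℝ) (A : Fin N → ℝ) : Set (Fin N → ℝ) :=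
  Sol lam (fun _ : Fin 1 => y) (Matrix.of fun _ j => A j)

def stsp1 {N : ℕ} (lam : ℝ) (y : ℝ) (A : Fin N → ℝ) : ℝ :=
  stsp lam (fun _ : Fin 1 => y) (Matrix.of fun _ j => A j)

/-- Euclidean norm on `ℝ^k`. -/
def l2norm {k : ℕ} (x : Fin k → ℝ) : ℝ := Real.sqrt (∑ i, x i ^ 2)

/-- Spectral norm (operator `2`-norm) of a matrix. -/
def specNorm {m N : ℕ} (A : Matrix (Fin m) (Fin N) ℝ) : ℝ :=
  sSup {v | ∃ x : Fin N → ℝ, l2norm x ≤ 1 ∧ v = l2norm (A.mulVec x)}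

/-- The truncated norm `⦀(y,A)⦀₂ = max{‖A‖₂, ‖y‖₂, 1}`. -/
def trNorm2 {m N : ℕ} (y : Fin m → ℝ) (A : Matrix (Fin m) (Fin N) ℝ) : ℝ :=
  max (specNorm A) (max (l2norm y) 1)

/-- The polynomial `q(ν,ξ) = 96ν⁵ + 12ν³(1 + λ√N)√ξ + ξ(2ν³/λ + 3ν)`. -/
def qpoly (N : ℕ) (lam ν ξ : ℝ) : ℝ :=
  96 * ν ^ 5 + 12 * ν ^ 3 * (1 + lam * Real.sqrt N) * Real.sqrt ξ +
    ξ * (2 * ν ^ 3 / lam + 3 * ν)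

/-- `‖A_{Sᶜ}ᵀ(Ax − y)‖_∞` where `S = supp x` (equal to `0` when `Sᶜ = ∅`). -/
def dualInfNorm {m N : ℕ} (y : Fin m → ℝ) (A : Matrix (Fin m) (Fin N) ℝ)
    (x : Fin N → ℝ) : ℝ :=
  sSup {v | ∃ j, j ∉ supp x ∧ v = |∑ i, A i j * (A.mulVec x i - y i)|}

/-- `σ₁(y,A) = inf{λ/2 − ‖A_{Sᶜ}ᵀ(Ax − y)‖_∞ : x ∈ Sol(y,A), S = supp x}` (in `[0,∞]`,
with `inf ∅ = ∞`). -/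
def sigma1 {m N : ℕ} (lam : ℝ) (y : Fin m → ℝ) (A : Matrix (Fin m) (Fin N) ℝ) : ℝ≥0∞ :=
  sInf {t | ∃ x ∈ Sol lam y A, t = ENNReal.ofReal (lam / 2 - dualInfNorm y A x)}

open scoped Classical in
/-- `‖(A_Sᵀ A_S)^{−1}‖₂^{−1}`, i.e. the smallest eigenvalue of the Gram matrix `A_Sᵀ A_S`
(`0` when the Gram matrix is singular, `∞` when `S = ∅`). -/
def gramInvNormInv {m N : ℕ} (A : Matrix (Fin m) (Fin N) ℝ) (S : Set (Fin N)) : ℝ≥0∞ :=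
  if S = ∅ then ⊤ else
    ENNReal.ofReal (sInf {v | ∃ z : Fin N → ℝ, (∀ j, j ∉ S → z j = 0) ∧
      (∑ j, z j ^ 2) = 1 ∧ v = ∑ i, (A.mulVec z i) ^ 2})

/-- `σ₂(y,A)`. -/
def sigma2 {m N : ℕ} (lam : ℝ) (y : Fin m → ℝ) (A : Matrix (Fin m) (Fin N) ℝ) : ℝ≥0∞ :=
  sInf {t | ∃ x ∈ Sol lam y A, t = gramInvNormInv A (supp x)}

/-- `σ₃(y,A) = inf{|x_i| : x ∈ Sol(y,A), x_i ≠ 0}` (with `inf ∅ = ∞`). -/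
def sigma3 {m N : ℕ} (lam : ℝ) (y : Fin m → ℝ) (A : Matrix (Fin m) (Fin N) ℝ) : ℝ≥0∞ :=
  sInf {t | ∃ (i : Fin N) (x : Fin N → ℝ), x ∈ Sol lam y A ∧ x i ≠ 0 ∧
    t = ENNReal.ofReal |x i|}

/-- `σ(y,A) = min{σ₁(y,A), σ₂(y,A)², σ₃(y,A)}`. -/
def sigmaUL {m N : ℕ} (lam : ℝ) (y : Fin m → ℝ) (A : Matrix (Fin m) (Fin N) ℝ) : ℝ≥0∞ :=
  min (sigma1 lam y A) (min ((sigma2 lam y A) ^ 2) (sigma3 lam y A))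

/-- `R : Ω → ℝ^k` is a centered Gaussian vector with covariance `Sig`: every linear
functional `⟨u, R⟩` is distributed as `N(0, uᵀ Sig u)`. -/
def IsCenteredGaussianVector {k : ℕ} {Ω : Type*} [MeasurableSpace Ω] (μ : Measure Ω)
    (Sig : Matrix (Fin k) (Fin k) ℝ) (R : Ω → Fin k → ℝ) : Prop :=
  ∀ u : Fin k → ℝ,
    Measure.map (fun ω => ∑ j, u j * R ω j) μ =
      gaussianReal 0 (Real.toNNReal (∑ j, ∑ l, u j * Sig j l * u l))

/-- Minimal eigenvalue of `Σ_{SS}` (Rayleigh quotient over unit vectors supported on `S`). -/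
def CminOf {N : ℕ} (Sig : Matrix (Fin N) (Fin N) ℝ) (S : Finset (Fin N)) : ℝ :=
  sInf {r | ∃ z : Fin N → ℝ, (∀ j ∉ S, z j = 0) ∧ (∑ j, z j ^ 2) = 1 ∧
    r = ∑ j, ∑ l, z j * Sig j l * z l}

/-- Maximal eigenvalue of `Σ_{SS}`. -/
def CmaxOf {N : ℕ} (Sig : Matrix (Fin N) (Fin N) ℝ) (S : Finset (Fin N)) : ℝ :=
  sSup {r | ∃ z : Fin N → ℝ, (∀ j ∉ S, z j = 0) ∧ (∑ j, z j ^ 2) = 1 ∧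
    r = ∑ j, ∑ l, z j * Sig j l * z l}

/-- Maximum absolute row sum norm `‖M‖_∞`. -/
def rowSumNorm {a b : Type*} [Fintype a] [Fintype b] (M : Matrix a b ℝ) : ℝ :=
  sSup (Set.range fun i : a => ∑ j, |M i j|)

/-- Submatrix `Σ_{ST}` of `Σ` with rows indexed by `S` and columns by `T`. -/
def subm {N : ℕ} (Sig : Matrix (Fin N) (Fin N) ℝ) (S T : Finset (Fin N)) :
    Matrix {i // i ∈ S} {j // j ∈ T} ℝ :=
  Matrix.of fun i j => Sig i.1 j.1

/-- `γ = 1 − ‖Σ_{SᶜS}(Σ_{SS})^{−1}‖_∞`. -/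
def gammaOf {N : ℕ} (Sig : Matrix (Fin N) (Fin N) ℝ) (S : Finset (Fin N)) : ℝ :=
  1 - rowSumNorm (subm Sig Sᶜ S * (subm Sig S S)⁻¹)

/-- `Σ_{Sᶜ|S} = Σ_{SᶜSᶜ} − Σ_{SᶜS}(Σ_{SS})^{−1}Σ_{SSᶜ}`. -/
def condCov {N : ℕ} (Sig : Matrix (Fin N) (Fin N) ℝ) (S : Finset (Fin N)) :
    Matrix {i // i ∈ Sᶜ} {j // j ∈ Sᶜ} ℝ :=
  subm Sig Sᶜ Sᶜ - subm Sig Sᶜ S * (subm Sig S S)⁻¹ * subm Sig S Sᶜ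

/-- `ρ_u`: maximal diagonal entry of `Σ_{Sᶜ|S}`. -/
def rhoUOf {N : ℕ} (Sig : Matrix (Fin N) (Fin N) ℝ) (S : Finset (Fin N)) : ℝ :=
  sSup (Set.range fun i : {j // j ∈ Sᶜ} => condCov Sig S i i)

/-- `θ_u = ρ_u/(C_min γ²)`. -/
def thetaUOf {N : ℕ} (Sig : Matrix (Fin N) (Fin N) ℝ) (S : Finset (Fin N)) : ℝ :=
  rhoUOf Sig S / (CminOf Sig S * gammaOf Sig S ^ 2)

/-- `φ_N = λ²/(8η² ln(N) C_min θ_u m)`. -/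
def phiNOf {N : ℕ} (lam η : ℝ) (m : ℕ) (Sig : Matrix (Fin N) (Fin N) ℝ)
    (S : Finset (Fin N)) : ℝ :=
  lam ^ 2 / (8 * η ^ 2 * Real.log N * CminOf Sig S * thetaUOf Sig S * m)

open scoped Classical in
/-- `Σ^{−1/2}`: the inverse of the positive semidefinite square root of `Σ`. -/
def sqrtInvMat {N : ℕ} (Sig : Matrix (Fin N) (Fin N) ℝ) : Matrix (Fin N) (Fin N) ℝ :=
  (if h : Sig.PosSemidef then
    (h.isHermitian.eigenvectorUnitary : Matrix (Fin N) (Fin N) ℝ) *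
      Matrix.diagonal (Real.sqrt ∘ h.isHermitian.eigenvalues) *
      (star h.isHermitian.eigenvectorUnitary : Matrix (Fin N) (Fin N) ℝ)
    else 1)⁻¹

/-- `g(λ) = c₃λ‖Σ^{−1/2}‖_∞²/(2m) + 20√(η² ln(s)/(C_min m))`. -/
def gOf {N : ℕ} (c3 lam η : ℝ) (m : ℕ) (Sig : Matrix (Fin N) (Fin N) ℝ)
    (S : Finset (Fin N)) : ℝ :=
  c3 * lam * (rowSumNorm (sqrtInvMat Sig)) ^ 2 / (2 * m) +
    20 * Real.sqrt (η ^ 2 * Real.log S.card / (CminOf Sig S * m))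

/-- `M̄_N(ε) = (1+ε)/(C_min θ_u m) · (s θ_u + m/(2 ln(N) φ_N))`. -/
def MbarOf {N : ℕ} (lam η : ℝ) (m : ℕ) (Sig : Matrix (Fin N) (Fin N) ℝ)
    (S : Finset (Fin N)) (ε : ℝ) : ℝ :=
  (1 + ε) / (CminOf Sig S * thetaUOf Sig S * m) *
    (S.card * thetaUOf Sig S + m / (2 * Real.log N * phiNOf lam η m Sig S))

/-- `min_{j ∈ supp v} |v_j|`. -/
def minAbsOn {N : ℕ} (v : Fin N → ℝ) : ℝ :=
  sInf {r | ∃ j, v j ≠ 0 ∧ r = |v j|}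

open scoped Classical in
/-- The support of `v` as a `Finset`. -/
def suppF {N : ℕ} (v : Fin N → ℝ) : Finset (Fin N) :=
  Finset.univ.filter fun j => v j ≠ 0

/-- The law of a vector of independent standard Gaussian coordinates. -/
abbrev stdG (ι : Type*) [Fintype ι] : Measure (ι → ℝ) := Measure.pi fun _ => gaussianReal 0 1

theorem stdG_map_mulVec {I J : Type*} [Fintype I] [Fintype J] [DecidableEq J]
    (L : Matrix J I ℝ) (hL : L * L.transpose = 1) :
    (stdG I).map L.mulVec = stdG J := by
  classical
  have hm : Measurable L.mulVec := by
    have : Continuous L.mulVec := by fun_prop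
    exact this.measurable
  have key : ((stdG I).map L.mulVec).map (WithLp.toLp 2) = (stdG J).map (WithLp.toLp 2) := by
    have : IsProbabilityMeasure ((stdG I).map L.mulVec) :=
      Measure.isProbabilityMeasure_map hm.aemeasurable
    have : IsProbabilityMeasure (((stdG I).map L.mulVec).map (WithLp.toLp 2)) :=
      Measure.isProbabilityMeasure_map (by fun_prop)
    rw [map_pi_eq_stdGaussian]
    apply Measure.ext_of_charFun
    ext t
    have hI := charFun_stdGaussian (E := EuclideanSpace ℝ I)
      (WithLp.toLp 2 (L.transpose.mulVec (WithLp.ofLp t)))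
    rw [charFun_stdGaussian]
    rw [← map_pi_eq_stdGaussian, charFun_apply, integral_map (by fun_prop) (by fun_prop)] at hI
    rw [charFun_apply, integral_map (by fun_prop) (by fun_prop),
      integral_map (by fun_prop) (by fun_prop)]
    have e1 : ∀ x : I → ℝ, inner ℝ (WithLp.toLp 2 (L.mulVec x)) t =
        inner ℝ (WithLp.toLp 2 x) (WithLp.toLp 2 (L.transpose.mulVec (WithLp.ofLp t))) := by
      intro x
      rw [EuclideanSpace.inner_eq_star_dotProduct, EuclideanSpace.inner_eq_star_dotProduct]
      simp [Matrix.dotProduct_mulVec, Matrix.mulVec_transpose, dotProduct_comm]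
    simp_rw [e1]
    rw [hI]
    have e2 : ‖WithLp.toLp 2 (L.transpose.mulVec (WithLp.ofLp t))‖ ^ 2 = ‖t‖ ^ 2 := by
      rw [← real_inner_self_eq_norm_sq, ← real_inner_self_eq_norm_sq,
        EuclideanSpace.inner_eq_star_dotProduct, EuclideanSpace.inner_eq_star_dotProduct]
      simp only [star_trivial]
      rw [Matrix.dotProduct_mulVec, Matrix.vecMul_transpose, Matrix.mulVec_mulVec, hL,
        Matrix.one_mulVec]
    congr 3
    exact_mod_cast e2
  have hid : ∀ ν : Measure (J → ℝ),
      (ν.map (WithLp.toLp 2)).map (WithLp.ofLp (p := 2) (V := J → ℝ)) = ν := fun ν => by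
    rw [Measure.map_map (by fun_prop) (by fun_prop)]
    exact Measure.map_id
  rw [← hid ((stdG I).map L.mulVec), key, hid]

theorem pi_chernoff {ι : Type*} [Fintype ι] (ν : Measure ℝ) [IsProbabilityMeasure ν]
    (f : ι → ℝ → ℝ) (hf : ∀ i, Integrable (fun x => exp (f i x)) ν) (r : ℝ) :
    (Measure.pi fun _ : ι => ν) {x | r ≤ ∑ i, f i (x i)} ≤
      ENNReal.ofReal (exp (-r) * ∏ i, ∫ x, exp (f i x) ∂ν) := by
  have hprod_int : Integrable (fun x : ι → ℝ => ∏ i, exp (f i (x i))) (Measure.pi fun _ : ι => ν) :=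
    Integrable.fintype_prod (f := fun i x => exp (f i x)) hf
  have h := mul_meas_ge_le_integral_of_nonneg (μ := Measure.pi fun _ : ι => ν)
    (ae_of_all _ fun x => Finset.prod_nonneg fun i _ => (exp_pos (f i (x i))).le) hprod_int (exp r)
  rw [integral_fintype_prod_eq_prod (fun i x => exp (f i x))] at h
  have hset : {x : ι → ℝ | exp r ≤ ∏ i, exp (f i (x i))} = {x | r ≤ ∑ i, f i (x i)} := by
    ext x
    simp [← Real.exp_sum]
  rw [hset] at h
  rw [← ofReal_measureReal (measure_ne_top _ _)]
  apply ENNReal.ofReal_le_ofReal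
  rw [exp_neg, inv_mul_eq_div, le_div_iff₀ (exp_pos r), mul_comm]
  exact h

theorem integrable_exp_mul_sq_gaussianReal {θ : ℝ} (hθ : θ < 1 / 2) :
    Integrable (fun x => exp (θ * x ^ 2)) (gaussianReal 0 1) := by
  rw [gaussianReal_of_var_ne_zero _ one_ne_zero, gaussianPDF_def,
    integrable_withDensity_iff_integrable_smul₀' (by fun_prop) (by simp)]
  have := (integrable_exp_neg_mul_sq (b := 1 / 2 - θ) (by linarith)).const_mul (√(2 * π))⁻¹
  refine this.congr (ae_of_all _ fun x => ?_)
  simp only [gaussianPDFReal_def, smul_eq_mul, NNReal.coe_one, mul_one, sub_zero]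
  rw [ENNReal.toReal_ofReal (by positivity), mul_assoc, ← exp_add]
  congr 2
  ring

theorem integral_exp_mul_sq_gaussianReal {θ : ℝ} (hθ : θ < 1 / 2) :
    ∫ x, exp (θ * x ^ 2) ∂(gaussianReal 0 1) = √(1 / (1 - 2 * θ)) := by
  rw [integral_gaussianReal_eq_integral_smul one_ne_zero]
  have : ∀ x : ℝ, gaussianPDFReal 0 1 x • exp (θ * x ^ 2) =
      (√(2 * π))⁻¹ * exp (-(1 / 2 - θ) * x ^ 2) := by
    intro x
    simp only [gaussianPDFReal_def, smul_eq_mul, NNReal.coe_one, mul_one, sub_zero]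
    rw [mul_assoc, ← exp_add]
    congr 2
    ring
  simp_rw [this]
  rw [integral_const_mul, integral_gaussian, ← Real.sqrt_inv, ← Real.sqrt_mul (by positivity)]
  congr 1
  have : 1 - 2 * θ ≠ 0 := by linarith
  have : 1 / 2 - θ ≠ 0 := by linarith
  field_simp

theorem stdG_sum_sq_ge {ι : Type*} [Fintype ι] (r : ℝ) :
    stdG ι {x | r ≤ ∑ i, x i ^ 2} ≤ ENNReal.ofReal (exp (-r / 4) * √2 ^ Fintype.card ι) := by
  have h := pi_chernoff (gaussianReal 0 1) (fun (_ : ι) x => (1 / 4) * x ^ 2)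
    (fun _ => integrable_exp_mul_sq_gaussianReal (by norm_num)) (r / 4)
  have hset : {x : ι → ℝ | r / 4 ≤ ∑ i, (1 / 4) * x i ^ 2} = {x | r ≤ ∑ i, x i ^ 2} := by
    ext x
    simp only [mem_ofPred_eq, ← Finset.mul_sum]
    constructor <;> intro h <;> linarith
  rw [hset] at h
  refine h.trans (ENNReal.ofReal_le_ofReal ?_)
  rw [Finset.prod_const, Finset.card_univ, integral_exp_mul_sq_gaussianReal (by norm_num)]
  norm_num
  rw [neg_div]

theorem stdG_sum_sq_le {ι : Type*} [Fintype ι] (r : ℝ) :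
    stdG ι {x | ∑ i, x i ^ 2 ≤ r} ≤ ENNReal.ofReal (exp r * √(1 / 3) ^ Fintype.card ι) := by
  have h := pi_chernoff (gaussianReal 0 1) (fun (_ : ι) x => (-1) * x ^ 2)
    (fun _ => integrable_exp_mul_sq_gaussianReal (by norm_num)) (-r)
  have hset : {x : ι → ℝ | -r ≤ ∑ i, (-1) * x i ^ 2} = {x | ∑ i, x i ^ 2 ≤ r} := by
    ext x
    simp only [mem_ofPred_eq, ← Finset.mul_sum]
    constructor <;> intro h <;> linarith
  rw [hset] at h
  refine h.trans (ENNReal.ofReal_le_ofReal ?_)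
  rw [Finset.prod_const, Finset.card_univ, integral_exp_mul_sq_gaussianReal (by norm_num)]
  norm_num

theorem stdG_linear_ge {ι : Type*} [Fintype ι] (u : ι → ℝ) {V t : ℝ} (hV : 0 < V) (ht : 0 ≤ t)
    (hu : ∑ i, u i ^ 2 ≤ V) :
    stdG ι {x | t ≤ ∑ i, x i * u i} ≤ ENNReal.ofReal (exp (-t ^ 2 / (2 * V))) := by
  have h := pi_chernoff (gaussianReal 0 1) (fun (i : ι) x => (t / V * u i) * x)
    (fun i => integrable_exp_mul_gaussianReal _) (t ^ 2 / V)
  have hsub : {x : ι → ℝ | t ≤ ∑ i, x i * u i} ⊆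
      {x | t ^ 2 / V ≤ ∑ i, (t / V * u i) * x i} := by
    intro x hx
    simp only [mem_ofPred_eq] at hx ⊢
    have : ∑ i, (t / V * u i) * x i = t / V * ∑ i, x i * u i := by
      rw [Finset.mul_sum]
      exact Finset.sum_congr rfl fun i _ => by ring
    rw [this, sq, mul_div_right_comm]
    exact mul_le_mul_of_nonneg_left hx (by positivity)
  refine (measure_mono hsub).trans (h.trans (ENNReal.ofReal_le_ofReal ?_))
  have hm : ∀ c : ℝ, ∫ x, exp (c * x) ∂(gaussianReal 0 1) = exp (c ^ 2 / 2) := by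
    intro c
    have := congrFun (mgf_fun_id_gaussianReal (μ := 0) (v := 1)) c
    simpa [mgf] using this
  simp_rw [hm]
  rw [← Real.exp_sum, ← exp_add, exp_le_exp]
  have : ∑ i, (t / V * u i) ^ 2 / 2 = (t / V) ^ 2 / 2 * ∑ i, u i ^ 2 := by
    rw [Finset.mul_sum]
    exact Finset.sum_congr rfl fun i _ => by ring
  rw [this]
  calc -(t ^ 2 / V) + (t / V) ^ 2 / 2 * ∑ i, u i ^ 2
      ≤ -(t ^ 2 / V) + (t / V) ^ 2 / 2 * V := by gcongr
    _ = -t ^ 2 / (2 * V) := by field_simp; ring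

theorem stdG_abs_linear_ge {ι : Type*} [Fintype ι] (u : ι → ℝ) {V t : ℝ} (hV : 0 < V)
    (ht : 0 ≤ t) (hu : ∑ i, u i ^ 2 ≤ V) :
    stdG ι {x | t ≤ |∑ i, x i * u i|} ≤ ENNReal.ofReal (2 * exp (-t ^ 2 / (2 * V))) := by
  have hsub : {x : ι → ℝ | t ≤ |∑ i, x i * u i|} ⊆
      {x | t ≤ ∑ i, x i * u i} ∪ {x | t ≤ ∑ i, x i * (-u) i} := by
    intro x hx
    simpa [le_abs] using hx
  refine (measure_mono hsub).trans ((measure_union_le _ _).trans ?_)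
  rw [two_mul, ENNReal.ofReal_add (exp_pos _).le (exp_pos _).le]
  exact add_le_add (stdG_linear_ge u hV ht hu) (stdG_linear_ge (-u) hV ht (by simpa using hu))

theorem prod_apply_le_of_sections {α β : Type*} [MeasurableSpace α] [MeasurableSpace β]
    (μ : Measure α) (ν : Measure β) [IsProbabilityMeasure μ] [SFinite ν]
    {B : Set (α × β)} (hB : MeasurableSet B) {κ : ℝ≥0∞} (h : ∀ a, ν {b | (a, b) ∈ B} ≤ κ) :
    (μ.prod ν) B ≤ κ := by
  rw [Measure.prod_apply hB]
  calc ∫⁻ a, ν (Prod.mk a ⁻¹' B) ∂μ ≤ ∫⁻ _, κ ∂μ := lintegral_mono fun a => h a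
    _ = κ := by simp

/-- Replace the `j`-th column of a matrix of entries by the vector `c`. -/
def setCol {m N : ℕ} (j : Fin N) (X : Fin m × Fin N → ℝ) (c : Fin m → ℝ) :
    Fin m × Fin N → ℝ := fun p => if p.2 = j then c p.1 else X p

theorem measurable_setCol {m N : ℕ} (j : Fin N) :
    Measurable fun q : (Fin m × Fin N → ℝ) × (Fin m → ℝ) => setCol j q.1 q.2 := by
  refine measurable_pi_lambda _ fun p => ?_
  by_cases h : p.2 = j
  · simp only [setCol, h, if_true]
    fun_prop
  · simp only [setCol, h, if_false]
    fun_prop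

theorem stdG_map_setCol {m N : ℕ} (j : Fin N) :
    ((stdG (Fin m × Fin N)).prod (stdG (Fin m))).map (fun q => setCol j q.1 q.2) =
      stdG (Fin m × Fin N) := by
  symm
  refine Measure.pi_eq fun s hs => ?_
  rw [Measure.map_apply (measurable_setCol j) (MeasurableSet.univ_pi hs)]
  have hpre : (fun q : (Fin m × Fin N → ℝ) × (Fin m → ℝ) => setCol j q.1 q.2) ⁻¹' (pi univ s) =
      (pi univ fun p => if p.2 = j then univ else s p) ×ˢ (pi univ fun i => s (i, j)) := by
    ext q
    simp only [mem_preimage, Set.mem_pi, mem_univ, true_imp_iff, mem_prod, setCol]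
    constructor
    · intro h
      refine ⟨fun p => ?_, fun i => ?_⟩
      · by_cases hp : p.2 = j
        · simp [hp]
        · simpa [hp] using h p
      · simpa using h (i, j)
    · rintro ⟨h1, h2⟩ ⟨i, k⟩
      by_cases hk : k = j
      · subst hk
        simpa using h2 i
      · simpa [hk] using h1 (i, k)
  rw [hpre, Measure.prod_prod, Measure.pi_pi, Measure.pi_pi, Fintype.prod_prod_type,
    Fintype.prod_prod_type, ← Finset.prod_mul_distrib]
  refine Finset.prod_congr rfl fun i _ => ?_
  rw [← Finset.mul_prod_erase _ (fun k => gaussianReal 0 1 (s (i, k))) (Finset.mem_univ j),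
    ← Finset.mul_prod_erase _ _ (Finset.mem_univ j), mul_comm]
  simp only [if_true, measure_univ, one_mul]
  congr 1
  refine Finset.prod_congr rfl fun k hk => ?_
  simp [Finset.ne_of_mem_erase hk]

theorem stdG_prod_le_of_setCol {m N : ℕ} {Y : Type*} [MeasurableSpace Y] (ρ : Measure Y)
    [IsProbabilityMeasure ρ] (j : Fin N) {B : Set ((Fin m × Fin N → ℝ) × Y)}
    (hB : MeasurableSet B) {κ : ℝ≥0∞}
    (h : ∀ X w, stdG (Fin m) {c | (setCol j X c, w) ∈ B} ≤ κ) :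
    ((stdG (Fin m × Fin N)).prod ρ) B ≤ κ := by
  rw [← Measure.prod_swap, Measure.map_apply measurable_swap hB]
  refine prod_apply_le_of_sections _ _ (measurable_swap hB) fun w => ?_
  have hBw : MeasurableSet {X : Fin m × Fin N → ℝ | (X, w) ∈ B} :=
    measurable_prodMk_right hB
  change stdG (Fin m × Fin N) {X | (X, w) ∈ B} ≤ κ
  rw [← stdG_map_setCol j, Measure.map_apply (measurable_setCol j) hBw]
  exact prod_apply_le_of_sections _ _ (measurable_setCol j hBw) fun X => h X w

theorem stdG_le_of_direction {m : ℕ} (e : Fin m → ℝ) (he : e ⬝ᵥ e = 1) {B : Set (Fin m → ℝ)}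
    (hB : MeasurableSet B) {κ : ℝ≥0∞}
    (h : ∀ c, gaussianReal 0 1 {t | c - (e ⬝ᵥ c) • e + t • e ∈ B} ≤ κ) :
    stdG (Fin m) B ≤ κ := by
  set L : Matrix (Fin m) (Fin m ⊕ Unit) ℝ :=
    Matrix.fromCols (1 - Matrix.vecMulVec e e) (Matrix.replicateCol Unit e) with hLdef
  have hL : L * L.transpose = 1 := by
    have h1 : Matrix.replicateCol Unit e * (Matrix.replicateCol Unit e).transpose =
        Matrix.vecMulVec e e := by
      rw [Matrix.transpose_replicateCol, Matrix.vecMulVec_eq Unit]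
    have h2 : Matrix.vecMulVec e e * Matrix.vecMulVec e e = Matrix.vecMulVec e e := by
      rw [Matrix.vecMulVec_mul_vecMulVec, he, one_smul]
    rw [hLdef, Matrix.transpose_fromCols, Matrix.fromCols_mul_fromRows, h1, Matrix.transpose_sub,
      Matrix.transpose_one, Matrix.transpose_vecMulVec, Matrix.sub_mul, Matrix.mul_sub,
      Matrix.mul_sub, h2]
    simp
  have hLm : Measurable L.mulVec := by
    have : Continuous L.mulVec := by fun_prop
    exact this.measurable
  have hmp := measurePreserving_sumPiEquivProdPi_symm
    (fun _ : Fin m ⊕ Unit => gaussianReal 0 1)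
  rw [← stdG_map_mulVec L hL, Measure.map_apply hLm hB, ← hmp.measure_preimage_equiv]
  refine prod_apply_le_of_sections _ _ ((MeasurableEquiv.measurable _) (hLm hB)) fun c => ?_
  have hu := measurePreserving_piUnique (fun _ : Unit => gaussianReal 0 1)
  refine le_trans (le_of_eq ?_) (h c)
  rw [← hu.measure_preimage_equiv]
  congr 1
  ext u
  simp only [mem_preimage, mem_ofPred_eq]
  have : L.mulVec ((MeasurableEquiv.sumPiEquivProdPi fun _ : Fin m ⊕ Unit => ℝ).symm (c, u)) =
      c - (e ⬝ᵥ c) • e + (u ()) • e := by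
    have hs : (MeasurableEquiv.sumPiEquivProdPi fun _ : Fin m ⊕ Unit => ℝ).symm (c, u) =
        Sum.elim c u := by
      ext x
      cases x <;> rfl
    rw [hs, hLdef, Matrix.fromCols_mulVec, Matrix.sub_mulVec, Matrix.one_mulVec]
    ext i
    simp [Matrix.vecMulVec, Matrix.mulVec, dotProduct, Finset.sum_mul]
    ring_nf
  rw [this]
  rfl

section

open Matrix

theorem lassoObj_eq_dotProduct {m N : ℕ} (lam : ℝ) (y : Fin m → ℝ)
    (A : Matrix (Fin m) (Fin N) ℝ) (x : Fin N → ℝ) :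
    lassoObj lam y A x = (y - A *ᵥ x) ⬝ᵥ (y - A *ᵥ x) + lam * ∑ j, |x j| := by
  simp only [lassoObj, dotProduct, Pi.sub_apply]
  congr 1
  exact Finset.sum_congr rfl fun i _ => by ring

/-- The minimizers of the LASSO objective among the vectors supported in `T`. -/
def restrictedSol {m N : ℕ} (lam : ℝ) (y : Fin m → ℝ) (A : Matrix (Fin m) (Fin N) ℝ)
    (T : Finset (Fin N)) : Set (Fin N → ℝ) :=
  {x | (∀ j ∉ T, x j = 0) ∧
    ∀ z : Fin N → ℝ, (∀ j ∉ T, z j = 0) → lassoObj lam y A x ≤ lassoObj lam y A z}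

theorem restrictedSol_univ {m N : ℕ} (lam : ℝ) (y : Fin m → ℝ) (A : Matrix (Fin m) (Fin N) ℝ) :
    restrictedSol lam y A Finset.univ = Sol lam y A := by
  ext x
  simp [restrictedSol, Sol]

/-- The correlations `Aᵀ(y - Ax)` of the columns with the residual. -/
def resCorr {m N : ℕ} (y : Fin m → ℝ) (A : Matrix (Fin m) (Fin N) ℝ) (x : Fin N → ℝ) :
    Fin N → ℝ := Matrix.vecMul (y - A.mulVec x) A

theorem continuous_lassoObj {m N : ℕ} (lam : ℝ) (y : Fin m → ℝ) (A : Matrix (Fin m) (Fin N) ℝ) :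
    Continuous (lassoObj lam y A) := by
  unfold lassoObj
  fun_prop

theorem restrictedSol_nonempty {m N : ℕ} {lam : ℝ} (hlam : 0 < lam) (y : Fin m → ℝ)
    (A : Matrix (Fin m) (Fin N) ℝ) (T : Finset (Fin N)) : (restrictedSol lam y A T).Nonempty := by
  set R := lassoObj lam y A 0 / lam with hR
  have h0 : 0 ≤ lassoObj lam y A 0 := by
    unfold lassoObj
    positivity
  have hcl : IsClosed {x : Fin N → ℝ | ∀ j ∉ T, x j = 0} := by
    simp only [Set.ofPred_forall]
    exact isClosed_iInter fun j => isClosed_iInter fun _ => isClosed_eq (by fun_prop) (by fun_prop)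
  have hcomp : IsCompact (Metric.closedBall (0 : Fin N → ℝ) R ∩ {x | ∀ j ∉ T, x j = 0}) :=
    (isCompact_closedBall _ _).inter_right hcl
  obtain ⟨x, ⟨hxR, hxT⟩, hx⟩ := hcomp.exists_isMinOn
    ⟨0, by simpa using div_nonneg h0 hlam.le, by simp⟩ (continuous_lassoObj lam y A).continuousOn
  refine ⟨x, hxT, fun z hz => ?_⟩
  by_cases hzR : ‖z‖ ≤ R
  · exact hx ⟨by simpa using hzR, hz⟩
  · have h1 : ‖z‖ ≤ ∑ j, |z j| :=
      (pi_norm_le_iff_of_nonneg (Finset.sum_nonneg fun _ _ => abs_nonneg _)).2 fun j =>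
        Finset.single_le_sum (f := fun j => |z j|) (fun _ _ => abs_nonneg _) (Finset.mem_univ j)
    have h2 : lassoObj lam y A 0 ≤ lam * ∑ j, |z j| := by
      rw [not_le, hR, div_lt_iff₀ hlam] at hzR
      nlinarith
    have h3 : lam * ∑ j, |z j| ≤ lassoObj lam y A z := by
      unfold lassoObj
      have : 0 ≤ ∑ i, (A.mulVec z i - y i) ^ 2 := by positivity
      linarith
    exact (hx ⟨by simpa using div_nonneg h0 hlam.le, by simp⟩ :
      lassoObj lam y A x ≤ lassoObj lam y A 0).trans (h2.trans h3)

theorem nonneg_of_forall_mul_add_nonneg {q c : ℝ} (h : ∀ t : ℝ, 0 < t → t ≤ 1 → 0 ≤ t * q + c) :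
    0 ≤ c := by
  have ht : Tendsto (fun t : ℝ => t * q + c) (nhdsWithin 0 (Ioi 0)) (nhds c) := by
    have : Continuous fun t : ℝ => t * q + c := by fun_prop
    simpa using (this.tendsto 0).mono_left nhdsWithin_le_nhds
  refine ge_of_tendsto ht ?_
  filter_upwards [Ioc_mem_nhdsGT (zero_lt_one' ℝ)] with t htt using h t htt.1 htt.2


theorem lassoObj_expand {m N : ℕ} (lam : ℝ) (y : Fin m → ℝ) (A : Matrix (Fin m) (Fin N) ℝ)
    (x z : Fin N → ℝ) : lassoObj lam y A z = lassoObj lam y A x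
      + (A *ᵥ (z - x)) ⬝ᵥ (A *ᵥ (z - x)) - 2 * (resCorr y A x ⬝ᵥ (z - x))
      + lam * (∑ j, |z j| - ∑ j, |x j|) := by
  have h : y - A *ᵥ z = (y - A *ᵥ x) - A *ᵥ (z - x) := by
    rw [mulVec_sub]
    abel
  rw [lassoObj_eq_dotProduct, lassoObj_eq_dotProduct, h, resCorr, ← dotProduct_mulVec]
  simp only [sub_dotProduct (y - A *ᵥ x), dotProduct_sub _ (y - A *ᵥ x)]
  rw [dotProduct_comm (A *ᵥ (z - x)) (y - A *ᵥ x)]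
  ring

theorem restrictedSol_variational {m N : ℕ} {lam : ℝ} (hlam : 0 ≤ lam) {y : Fin m → ℝ}
    {A : Matrix (Fin m) (Fin N) ℝ} {T : Finset (Fin N)} {x z : Fin N → ℝ}
    (hx : x ∈ restrictedSol lam y A T) (hz : ∀ j ∉ T, z j = 0) :
    2 * (resCorr y A x ⬝ᵥ (z - x)) ≤ lam * (∑ j, |z j| - ∑ j, |x j|) := by
  rw [← sub_nonneg]
  refine nonneg_of_forall_mul_add_nonneg (q := (A *ᵥ (z - x)) ⬝ᵥ (A *ᵥ (z - x))) fun t ht0 ht1 => ?_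
  have h1 := hx.2 (x + t • (z - x)) fun j hj => by simp [hx.1 j hj, hz j hj]
  rw [lassoObj_expand lam y A x (x + t • (z - x))] at h1
  have h2 : ∑ j, |(x + t • (z - x)) j| ≤ (1 - t) * ∑ j, |x j| + t * ∑ j, |z j| := by
    rw [Finset.mul_sum, Finset.mul_sum, ← Finset.sum_add_distrib]
    refine Finset.sum_le_sum fun j _ => ?_
    have : (x + t • (z - x)) j = (1 - t) * x j + t * z j := by
      simp
      ring
    rw [this]
    refine (abs_add_le _ _).trans_eq ?_
    rw [abs_mul, abs_mul, abs_of_nonneg (sub_nonneg.2 ht1), abs_of_pos ht0]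
  have h3 := mul_le_mul_of_nonneg_left h2 hlam
  simp only [add_sub_cancel_left, mulVec_smul, smul_dotProduct, dotProduct_smul, smul_eq_mul] at h1
  refine nonneg_of_mul_nonneg_right ?_ ht0
  nlinarith

theorem abs_resCorr_le {m N : ℕ} {lam : ℝ} (hlam : 0 ≤ lam) {y : Fin m → ℝ}
    {A : Matrix (Fin m) (Fin N) ℝ} {T : Finset (Fin N)} {x : Fin N → ℝ}
    (hx : x ∈ restrictedSol lam y A T) {j : Fin N} (hj : j ∈ T) : |resCorr y A x j| ≤ lam / 2 := by
  have key : ∀ s : ℝ, |s| = 1 → s * resCorr y A x j ≤ lam / 2 := fun s hs => by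
    have h1 := restrictedSol_variational hlam hx (z := x + Pi.single j s) fun k hk => by
      have : k ≠ j := fun h => hk (h ▸ hj)
      simp [hx.1 k hk, this]
    have h2 : ∑ k, |(x + (Pi.single j s : Fin N → ℝ)) k| ≤ ∑ k, |x k| + 1 := by
      calc ∑ k, |(x + (Pi.single j s : Fin N → ℝ)) k| ≤ ∑ k, (|x k| + |(Pi.single j s : Fin N → ℝ) k|) :=
            Finset.sum_le_sum fun k _ => abs_add_le _ _
        _ = ∑ k, |x k| + 1 := by
            rw [Finset.sum_add_distrib]
            congr 1
            rw [Finset.sum_eq_single j (fun k _ hk => by simp [hk]) (by simp)]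
            simp [hs]
    have h3 := mul_le_mul_of_nonneg_left h2 hlam
    rw [add_sub_cancel_left, dotProduct_single] at h1
    nlinarith
  rw [abs_le]
  constructor
  · linarith [key (-1) (by simp)]
  · linarith [key 1 (by simp)]

theorem resCorr_dotProduct_eq {m N : ℕ} {lam : ℝ} (hlam : 0 ≤ lam) {y : Fin m → ℝ}
    {A : Matrix (Fin m) (Fin N) ℝ} {T : Finset (Fin N)} {x : Fin N → ℝ}
    (hx : x ∈ restrictedSol lam y A T) : resCorr y A x ⬝ᵥ x = lam / 2 * ∑ j, |x j| := by
  have h1 := restrictedSol_variational hlam hx (z := 0) (by simp)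
  have h2 := restrictedSol_variational hlam hx (z := x + x) fun j hj => by simp [hx.1 j hj]
  have h3 : ∑ j, |(x + x) j| = 2 * ∑ j, |x j| := by
    rw [Finset.mul_sum]
    refine Finset.sum_congr rfl fun j _ => ?_
    rw [Pi.add_apply, ← two_mul, abs_mul]
    simp
  rw [h3, add_sub_cancel_left] at h2
  simp only [zero_sub, dotProduct_neg, Pi.zero_apply, abs_zero, Finset.sum_const_zero] at h1
  linarith

theorem mem_restrictedSol_iff {m N : ℕ} {lam : ℝ} (hlam : 0 ≤ lam) {y : Fin m → ℝ}
    {A : Matrix (Fin m) (Fin N) ℝ} {T : Finset (Fin N)} {x : Fin N → ℝ} :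
    x ∈ restrictedSol lam y A T ↔ (∀ j ∉ T, x j = 0) ∧ (∀ j ∈ T, |resCorr y A x j| ≤ lam / 2) ∧
      resCorr y A x ⬝ᵥ x = lam / 2 * ∑ j, |x j| := by
  refine ⟨fun hx => ⟨hx.1, fun j hj => abs_resCorr_le hlam hx hj, resCorr_dotProduct_eq hlam hx⟩, ?_⟩
  rintro ⟨h1, h2, h3⟩
  refine ⟨h1, fun z hz => ?_⟩
  have h4 : resCorr y A x ⬝ᵥ z ≤ lam / 2 * ∑ j, |z j| := by
    rw [dotProduct, Finset.mul_sum]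
    refine Finset.sum_le_sum fun j _ => ?_
    by_cases hj : j ∈ T
    · refine (le_abs_self _).trans ?_
      rw [abs_mul]
      exact mul_le_mul_of_nonneg_right (h2 j hj) (abs_nonneg _)
    · simp [hz j hj]
  have h5 : 0 ≤ (A *ᵥ (z - x)) ⬝ᵥ (A *ᵥ (z - x)) := Finset.sum_nonneg fun _ _ => mul_self_nonneg _
  rw [lassoObj_expand lam y A x z, dotProduct_sub, h3]
  linarith

theorem mulVec_eq_of_mem_restrictedSol {m N : ℕ} {lam : ℝ} (hlam : 0 ≤ lam) {y : Fin m → ℝ}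
    {A : Matrix (Fin m) (Fin N) ℝ} {T : Finset (Fin N)} {x z : Fin N → ℝ}
    (hx : x ∈ restrictedSol lam y A T) (hz : z ∈ restrictedSol lam y A T) : A *ᵥ x = A *ᵥ z := by
  have h1 := restrictedSol_variational hlam hx hz.1
  have h2 := hz.2 x hx.1
  rw [lassoObj_expand lam y A x z] at h2
  have h3 : (A *ᵥ (z - x)) ⬝ᵥ (A *ᵥ (z - x)) = 0 :=
    le_antisymm (by linarith) (Finset.sum_nonneg fun _ _ => mul_self_nonneg _)
  rw [dotProduct_self_eq_zero, mulVec_sub, sub_eq_zero] at h3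
  exact h3.symm

theorem resCorr_congr {m N : ℕ} {y : Fin m → ℝ} {A : Matrix (Fin m) (Fin N) ℝ} {x z : Fin N → ℝ}
    (h : A *ᵥ x = A *ᵥ z) : resCorr y A x = resCorr y A z := by
  rw [resCorr, resCorr, h]

theorem restrictedSol_of_subset {m N : ℕ} {lam : ℝ} {y : Fin m → ℝ}
    {A : Matrix (Fin m) (Fin N) ℝ} {T T' : Finset (Fin N)} (hT : T ⊆ T') {x : Fin N → ℝ}
    (hx : x ∈ restrictedSol lam y A T') (hxT : ∀ j ∉ T, x j = 0) : x ∈ restrictedSol lam y A T :=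
  ⟨hxT, fun z hz => hx.2 z fun j hj => hz j fun h => hj (hT h)⟩

theorem restrictedSol_enlarge {m N : ℕ} {lam : ℝ} (hlam : 0 ≤ lam) {y : Fin m → ℝ}
    {A : Matrix (Fin m) (Fin N) ℝ} {T T' : Finset (Fin N)} (hT : T ⊆ T') {x : Fin N → ℝ}
    (hx : x ∈ restrictedSol lam y A T) (h : ∀ j ∈ T', j ∉ T → |resCorr y A x j| ≤ lam / 2) :
    x ∈ restrictedSol lam y A T' := by
  rw [mem_restrictedSol_iff hlam] at hx ⊢
  refine ⟨fun j hj => hx.1 j fun h => hj (hT h), fun j hj => ?_, hx.2.2⟩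
  by_cases hjT : j ∈ T
  · exact hx.2.1 j hjT
  · exact h j hj hjT

theorem eq_zero_of_abs_resCorr_lt {m N : ℕ} {lam : ℝ} (hlam : 0 ≤ lam) {y : Fin m → ℝ}
    {A : Matrix (Fin m) (Fin N) ℝ} {z : Fin N → ℝ} (hz : z ∈ restrictedSol lam y A Finset.univ)
    {j : Fin N} (hj : |resCorr y A z j| < lam / 2) : z j = 0 := by
  rw [mem_restrictedSol_iff hlam] at hz
  have h1 : ∀ k ∈ Finset.univ, 0 ≤ lam / 2 * |z k| - resCorr y A z k * z k := fun k hk => by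
    have := mul_le_mul_of_nonneg_right (hz.2.1 k hk) (abs_nonneg (z k))
    rw [← abs_mul] at this
    linarith [le_abs_self (resCorr y A z k * z k)]
  have h2 : ∑ k, (lam / 2 * |z k| - resCorr y A z k * z k) = 0 := by
    rw [Finset.sum_sub_distrib, ← Finset.mul_sum, ← hz.2.2, dotProduct, sub_self]
  have h3 := (Finset.sum_eq_zero_iff_of_nonneg h1).1 h2 j (Finset.mem_univ j)
  by_contra hne
  have h4 := mul_lt_mul_of_pos_right hj (abs_pos.2 hne)
  rw [← abs_mul] at h4
  linarith [le_abs_self (resCorr y A z j * z j)]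

/-- `A` is injective on the vectors supported in `T`. -/
def InjOnSupp {m N : ℕ} (A : Matrix (Fin m) (Fin N) ℝ) (T : Finset (Fin N)) : Prop :=
  ∀ z : Fin N → ℝ, (∀ j ∉ T, z j = 0) → A *ᵥ z = 0 → z = 0

theorem restrictedSol_subsingleton {m N : ℕ} {lam : ℝ} (hlam : 0 ≤ lam) {y : Fin m → ℝ}
    {A : Matrix (Fin m) (Fin N) ℝ} {T : Finset (Fin N)} (hA : InjOnSupp A T) {x z : Fin N → ℝ}
    (hx : x ∈ restrictedSol lam y A T) (hz : z ∈ restrictedSol lam y A T) : x = z := by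
  have h := mulVec_eq_of_mem_restrictedSol hlam hx hz
  refine sub_eq_zero.1 (hA (x - z) (fun j hj => by simp [hx.1 j hj, hz.1 j hj]) ?_)
  rw [mulVec_sub, h, sub_self]

theorem mem_restrictedSol_of_mem_Sol {m N : ℕ} {lam : ℝ} (hlam : 0 < lam) {y : Fin m → ℝ}
    {A : Matrix (Fin m) (Fin N) ℝ} {T : Finset (Fin N)}
    (h : ∀ x ∈ restrictedSol lam y A T, ∀ j ∉ T, |resCorr y A x j| < lam / 2) {z : Fin N → ℝ}
    (hz : z ∈ Sol lam y A) : z ∈ restrictedSol lam y A T := by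
  obtain ⟨x, hx⟩ := restrictedSol_nonempty hlam y A T
  have hx' := restrictedSol_enlarge hlam.le (Finset.subset_univ T) hx
    fun j _ hj => (h x hx j hj).le
  rw [← restrictedSol_univ] at hz
  refine restrictedSol_of_subset (Finset.subset_univ T) hz fun j hj => ?_
  refine eq_zero_of_abs_resCorr_lt hlam.le hz ?_
  rw [← resCorr_congr (mulVec_eq_of_mem_restrictedSol hlam.le hx' hz)]
  exact h x hx j hj

theorem coord_ne_zero_iff_of_erase {m N : ℕ} {lam : ℝ} (hlam : 0 ≤ lam) {y : Fin m → ℝ}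
    {A : Matrix (Fin m) (Fin N) ℝ} {T : Finset (Fin N)} (hA : InjOnSupp A T) {x u : Fin N → ℝ}
    (hx : x ∈ restrictedSol lam y A T) {j : Fin N} (hj : j ∈ T)
    (hu : u ∈ restrictedSol lam y A (T.erase j)) : x j ≠ 0 ↔ lam / 2 < |resCorr y A u j| := by
  constructor
  · intro hxj
    by_contra! hle
    have hu' : u ∈ restrictedSol lam y A T :=
      restrictedSol_enlarge hlam (Finset.erase_subset j T) hu fun k hk hk' => by
        have : k = j := by
          by_contra hne
          exact hk' (Finset.mem_erase.2 ⟨hne, hk⟩)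
        rwa [this]
    rw [restrictedSol_subsingleton hlam hA hx hu'] at hxj
    exact hxj (hu.1 j (Finset.notMem_erase j T))
  · intro hlt hxj
    have hx' : x ∈ restrictedSol lam y A (T.erase j) :=
      restrictedSol_of_subset (Finset.erase_subset j T) hx fun k hk => by
        by_cases hkj : k = j
        · rwa [hkj]
        · exact hx.1 k fun h => hk (Finset.mem_erase.2 ⟨hkj, h⟩)
    rw [← resCorr_congr (mulVec_eq_of_mem_restrictedSol hlam hx' hu)] at hlt
    exact absurd (abs_resCorr_le hlam hx hj) (not_le.2 hlt)

/-- The Euclidean norm of a vector. -/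
def euc {ι : Type*} [Fintype ι] (x : ι → ℝ) : ℝ := ‖WithLp.toLp 2 x‖

theorem euc_nonneg {ι : Type*} [Fintype ι] (x : ι → ℝ) : 0 ≤ euc x := norm_nonneg _

theorem euc_sq {ι : Type*} [Fintype ι] (x : ι → ℝ) : euc x ^ 2 = ∑ i, x i ^ 2 := by
  rw [euc, EuclideanSpace.norm_sq_eq]
  simp

theorem euc_sq_eq_dotProduct {ι : Type*} [Fintype ι] (x : ι → ℝ) : euc x ^ 2 = x ⬝ᵥ x := by
  rw [euc_sq, dotProduct]
  exact Finset.sum_congr rfl fun i _ => sq (x i)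

theorem euc_eq_sqrt {ι : Type*} [Fintype ι] (x : ι → ℝ) : euc x = √(∑ i, x i ^ 2) := by
  rw [← euc_sq, Real.sqrt_sq (euc_nonneg x)]

theorem euc_le_of_sq_le {ι : Type*} [Fintype ι] {x : ι → ℝ} {b : ℝ} (hb : 0 ≤ b)
    (h : ∑ i, x i ^ 2 ≤ b ^ 2) : euc x ≤ b := by
  rw [← euc_sq] at h
  exact le_of_sq_le_sq h hb

theorem euc_add_le {ι : Type*} [Fintype ι] (x y : ι → ℝ) : euc (x + y) ≤ euc x + euc y := by
  simpa [euc] using norm_add_le (WithLp.toLp 2 x) (WithLp.toLp 2 y)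

theorem euc_neg {ι : Type*} [Fintype ι] (x : ι → ℝ) : euc (-x) = euc x := by
  simp [euc]

theorem euc_sub_le {ι : Type*} [Fintype ι] (x y : ι → ℝ) : euc (x - y) ≤ euc x + euc y := by
  rw [sub_eq_add_neg, ← euc_neg y]
  exact euc_add_le _ _

theorem euc_smul {ι : Type*} [Fintype ι] (t : ℝ) (x : ι → ℝ) : euc (t • x) = |t| * euc x := by
  simp [euc, norm_smul]

theorem euc_eq_zero {ι : Type*} [Fintype ι] {x : ι → ℝ} : euc x = 0 ↔ x = 0 := by
  simp [euc]

theorem euc_zero {ι : Type*} [Fintype ι] : euc (0 : ι → ℝ) = 0 := euc_eq_zero.2 rfl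

theorem continuous_euc {ι : Type*} [Fintype ι] : Continuous (euc : (ι → ℝ) → ℝ) := by
  unfold euc
  fun_prop

theorem abs_dotProduct_le {ι : Type*} [Fintype ι] (x y : ι → ℝ) : |x ⬝ᵥ y| ≤ euc x * euc y := by
  have h := abs_real_inner_le_norm (WithLp.toLp 2 x) (WithLp.toLp 2 y)
  rw [EuclideanSpace.inner_eq_star_dotProduct] at h
  simpa [euc, dotProduct_comm] using h

theorem euc_le_of_abs_le {ι : Type*} [Fintype ι] {x : ι → ℝ} {δ : ℝ}
    (h : ∀ i, |x i| ≤ δ) : euc x ≤ √(Fintype.card ι) * δ := by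
  rcases isEmpty_or_nonempty ι with hι | ⟨⟨i₀⟩⟩
  · have : x = 0 := Subsingleton.elim _ _
    simp [this, euc_zero]
  have hδ : 0 ≤ δ := (abs_nonneg _).trans (h i₀)
  refine euc_le_of_sq_le (by positivity) ?_
  rw [mul_pow, Real.sq_sqrt (Nat.cast_nonneg _)]
  calc ∑ i, x i ^ 2 ≤ ∑ _i : ι, δ ^ 2 :=
        Finset.sum_le_sum fun i _ => by
          rw [← sq_abs]
          exact pow_le_pow_left₀ (abs_nonneg _) (h i) 2
    _ = _ := by simp

theorem euc_mulVec_le_of_abs_le {m N : ℕ} {D : Matrix (Fin m) (Fin N) ℝ} {δ : ℝ}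
    (h : ∀ i j, |D i j| ≤ δ) (z : Fin N → ℝ) :
    euc (D *ᵥ z) ≤ √((m : ℝ) * N) * δ * euc z := by
  have hrow : ∀ i, |(D *ᵥ z) i| ≤ √(N : ℝ) * δ * euc z := fun i => by
    refine (abs_dotProduct_le (D i) z).trans ?_
    have := euc_le_of_abs_le (h i)
    rw [Fintype.card_fin] at this
    exact mul_le_mul_of_nonneg_right this (euc_nonneg _)
  have := euc_le_of_abs_le hrow
  rw [Fintype.card_fin] at this
  rw [Real.sqrt_mul (Nat.cast_nonneg m)]
  linarith

theorem restrictedSol_sq_le {m N : ℕ} {lam : ℝ} (hlam : 0 ≤ lam) {y : Fin m → ℝ}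
    {A : Matrix (Fin m) (Fin N) ℝ} {T : Finset (Fin N)} {x : Fin N → ℝ}
    (hx : x ∈ restrictedSol lam y A T) :
    euc (y - A *ᵥ x) ≤ euc y ∧ euc (A *ᵥ x) ≤ euc y := by
  have h1 := resCorr_dotProduct_eq hlam hx
  rw [resCorr, ← dotProduct_mulVec] at h1
  have h2 : 0 ≤ lam / 2 * ∑ j, |x j| := by positivity
  have h3 : euc y ^ 2 = euc (y - A *ᵥ x) ^ 2 + 2 * ((y - A *ᵥ x) ⬝ᵥ (A *ᵥ x)) +
      euc (A *ᵥ x) ^ 2 := by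
    simp only [euc_sq_eq_dotProduct, sub_dotProduct, dotProduct_sub]
    rw [dotProduct_comm (A *ᵥ x) y]
    ring
  constructor
  · refine le_of_sq_le_sq ?_ (euc_nonneg y)
    nlinarith [sq_nonneg (euc (A *ᵥ x))]
  · refine le_of_sq_le_sq ?_ (euc_nonneg y)
    nlinarith [sq_nonneg (euc (y - A *ᵥ x))]

theorem restrictedSol_stability {m N : ℕ} {lam : ℝ} (hlam : 0 ≤ lam) {y y' : Fin m → ℝ}
    {A A' : Matrix (Fin m) (Fin N) ℝ} {T : Finset (Fin N)} {x x' : Fin N → ℝ}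
    (hx : x ∈ restrictedSol lam y A T) (hx' : x' ∈ restrictedSol lam y' A' T) :
    euc (A' *ᵥ (x' - x)) ^ 2 ≤ (y - A *ᵥ x) ⬝ᵥ ((A' - A) *ᵥ (x' - x)) +
      ((y' - y) - (A' - A) *ᵥ x) ⬝ᵥ (A' *ᵥ (x' - x)) := by
  have h1 := restrictedSol_variational hlam hx hx'.1
  have h2 := restrictedSol_variational hlam hx' hx.1
  rw [resCorr, ← dotProduct_mulVec] at h1 h2
  rw [euc_sq_eq_dotProduct]
  simp only [mulVec_sub, sub_mulVec, sub_dotProduct, dotProduct_sub] at h1 h2 ⊢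
  linarith

theorem euc_mulVec_perturbed_ge {m N : ℕ} {τ δ : ℝ} {A A' : Matrix (Fin m) (Fin N) ℝ}
    {S : Finset (Fin N)} (hm : 1 ≤ m) (hτ : √((m : ℝ) * N) * δ = τ) (hτ' : τ ≤ 1 / 100)
    (hA : ∀ z : Fin N → ℝ, (∀ j ∉ S, z j = 0) → (m : ℝ) / 3 * euc z ^ 2 ≤ euc (A *ᵥ z) ^ 2)
    (hAA : ∀ i j, |A' i j - A i j| ≤ δ) {z : Fin N → ℝ} (hz : ∀ j ∉ S, z j = 0) :
    √(m : ℝ) * euc z ≤ 7 / 4 * euc (A *ᵥ z) ∧ √(m : ℝ) * euc z ≤ 2 * euc (A' *ᵥ z) := by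
  have hM : 1 ≤ √(m : ℝ) := Real.one_le_sqrt.2 (by exact_mod_cast hm)
  have h1 : √(m : ℝ) * euc z ≤ 7 / 4 * euc (A *ᵥ z) := by
    refine le_of_sq_le_sq ?_ (by have := euc_nonneg (A *ᵥ z); positivity)
    rw [mul_pow, mul_pow, Real.sq_sqrt (Nat.cast_nonneg m)]
    have := hA z hz
    nlinarith [sq_nonneg (euc (A *ᵥ z))]
  refine ⟨h1, ?_⟩
  have h2 : euc ((A' - A) *ᵥ z) ≤ τ * euc z := hτ ▸ euc_mulVec_le_of_abs_le (fun i j => hAA i j) z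
  have h3 : A *ᵥ z = A' *ᵥ z - (A' - A) *ᵥ z := by
    rw [sub_mulVec]
    abel
  have h4 : euc (A *ᵥ z) ≤ euc (A' *ᵥ z) + euc ((A' - A) *ᵥ z) := by
    rw [h3]
    exact euc_sub_le _ _
  have h5 := mul_le_mul_of_nonneg_right hτ' (euc_nonneg z)
  have h6 := mul_le_mul_of_nonneg_right hM (euc_nonneg z)
  linarith [euc_nonneg z]

theorem injOnSupp_of_euc_le {m N : ℕ} {A : Matrix (Fin m) (Fin N) ℝ} {S : Finset (Fin N)}
    {c : ℝ} (hm : 1 ≤ m)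
    (hA : ∀ z : Fin N → ℝ, (∀ j ∉ S, z j = 0) → √(m : ℝ) * euc z ≤ c * euc (A *ᵥ z)) :
    InjOnSupp A S := fun z hz h0 => by
  have hM : 1 ≤ √(m : ℝ) := Real.one_le_sqrt.2 (by exact_mod_cast hm)
  have h1 := hA z hz
  rw [h0, euc_zero, mul_zero] at h1
  have h2 := mul_le_mul_of_nonneg_right hM (euc_nonneg z)
  exact euc_eq_zero.1 (le_antisymm (by linarith) (euc_nonneg z))

theorem abs_resCorr_sub_le {m N : ℕ} {lam α τ δ : ℝ} (hlam : 0 ≤ lam) {y y' : Fin m → ℝ}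
    {A A' : Matrix (Fin m) (Fin N) ℝ} {S T : Finset (Fin N)} (hTS : T ⊆ S) (hm : 1 ≤ m)
    (hN : 1 ≤ N) (hδ : 0 ≤ δ) (hα : 3 * √(m : ℝ) ≤ α)
    (hτ : √((m : ℝ) * N) * δ = τ) (hτ' : τ ≤ 1 / 100)
    (hA : ∀ z : Fin N → ℝ, (∀ j ∉ S, z j = 0) → (m : ℝ) / 3 * euc z ^ 2 ≤ euc (A *ᵥ z) ^ 2)
    (hcol : ∀ j, euc (fun i => A i j) ≤ α) (hy : euc y ≤ α)
    (hyy : ∀ i, |y' i - y i| ≤ δ) (hAA : ∀ i j, |A' i j - A i j| ≤ δ) {x x' : Fin N → ℝ}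
    (hx : x ∈ restrictedSol lam y A T) (hx' : x' ∈ restrictedSol lam y' A' T) (j : Fin N) :
    |resCorr y' A' x' j - resCorr y A x j| ≤ 10 * τ * α ^ 2 := by
  have hM : 1 ≤ √(m : ℝ) := Real.one_le_sqrt.2 (by exact_mod_cast hm)
  have hsuppS : ∀ z : Fin N → ℝ, (∀ j ∉ T, z j = 0) → ∀ j ∉ S, z j = 0 :=
    fun z hz j hj => hz j fun h => hj (hTS h)
  have hτ0 : 0 ≤ τ := hτ ▸ by positivity
  have hMδ : √(m : ℝ) * δ ≤ τ := by
    rw [← hτ]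
    refine mul_le_mul_of_nonneg_right (Real.sqrt_le_sqrt ?_) hδ
    have : (1 : ℝ) ≤ N := by exact_mod_cast hN
    nlinarith [Nat.cast_nonneg (α := ℝ) m]
  have hD : ∀ z, euc ((A' - A) *ᵥ z) ≤ τ * euc z := fun z =>
    hτ ▸ euc_mulVec_le_of_abs_le (fun i j => hAA i j) z
  have he : euc (y' - y) ≤ τ := by
    refine le_trans ?_ hMδ
    have := euc_le_of_abs_le (x := y' - y) hyy
    rwa [Fintype.card_fin] at this
  have hX : √(m : ℝ) * euc x ≤ 7 / 4 * α := by
    have h1 := (euc_mulVec_perturbed_ge hm hτ hτ' hA hAA (hsuppS x hx.1)).1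
    have h2 := (restrictedSol_sq_le hlam hx).2
    linarith
  have hd : √(m : ℝ) * euc (x' - x) ≤ 2 * euc (A' *ᵥ (x' - x)) :=
    (euc_mulVec_perturbed_ge hm hτ hτ' hA hAA
      (hsuppS _ fun j hj => by simp [hx.1 j hj, hx'.1 j hj])).2
  have hr : euc (y - A *ᵥ x) ≤ α := (restrictedSol_sq_le hlam hx).1.trans hy
  have hα1 : 1 ≤ α := by linarith
  have hX0 := euc_nonneg x
  have hX2 : euc x ≤ 7 / 4 * α := by nlinarith
  have hu0 := euc_nonneg (A' *ᵥ (x' - x))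
  have hDx : euc (y' - y - (A' - A) *ᵥ x) ≤ τ + τ * euc x :=
    (euc_sub_le _ _).trans (add_le_add he (hD x))
  have hu : euc (A' *ᵥ (x' - x)) ≤ 5 * α * τ := by
    have h1 := restrictedSol_stability hlam hx hx'
    have h2 : (y - A *ᵥ x) ⬝ᵥ ((A' - A) *ᵥ (x' - x)) ≤ α * (τ * euc (x' - x)) :=
      (le_abs_self _).trans ((abs_dotProduct_le _ _).trans
        (mul_le_mul hr (hD _) (euc_nonneg _) (by linarith)))
    have h3 : (y' - y - (A' - A) *ᵥ x) ⬝ᵥ (A' *ᵥ (x' - x)) ≤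
        (τ + τ * euc x) * euc (A' *ᵥ (x' - x)) :=
      (le_abs_self _).trans ((abs_dotProduct_le _ _).trans
        (mul_le_mul_of_nonneg_right hDx hu0))
    set u := euc (A' *ᵥ (x' - x))
    set M := √(m : ℝ)
    have h4 : M * u ^ 2 ≤ M * (α * (τ * euc (x' - x)) + (τ + τ * euc x) * u) :=
      mul_le_mul_of_nonneg_left (by linarith) (by linarith)
    have h5 : α * τ * (M * euc (x' - x)) ≤ α * τ * (2 * u) :=
      mul_le_mul_of_nonneg_left hd (by positivity)
    have h6 : τ * u * (M * euc x) ≤ τ * u * (7 / 4 * α) :=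
      mul_le_mul_of_nonneg_left hX (by positivity)
    have h7 : τ * u * M ≤ τ * u * (α / 3) :=
      mul_le_mul_of_nonneg_left (by linarith) (by positivity)
    have h8 : 0 ≤ α * τ * u := by positivity
    have h9 : u * (M * u) ≤ u * (5 * α * τ) := by nlinarith
    rcases hu0.eq_or_lt with h0 | hpos
    · rw [← h0]
      positivity
    · have := le_of_mul_le_mul_left h9 hpos
      nlinarith
  have hr' : (y' - A' *ᵥ x') - (y - A *ᵥ x) =
      (y' - y - (A' - A) *ᵥ x) - A' *ᵥ (x' - x) := by
    rw [sub_mulVec, mulVec_sub]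
    abel
  have hdr : euc ((y' - A' *ᵥ x') - (y - A *ᵥ x)) ≤ 8 * α * τ := by
    rw [hr']
    have h1 : τ * euc x ≤ τ * (7 / 4 * α) := mul_le_mul_of_nonneg_left hX2 hτ0
    have h2 : τ * 1 ≤ τ * α := mul_le_mul_of_nonneg_left hα1 hτ0
    have h3 : 0 ≤ τ * α := by positivity
    refine (euc_sub_le _ _).trans ((add_le_add hDx hu).trans ?_)
    linarith
  have hr'n : euc (y' - A' *ᵥ x') ≤ 2 * α := by
    refine (restrictedSol_sq_le hlam hx').1.trans ?_
    have : y' = y + (y' - y) := by abel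
    rw [this]
    refine (euc_add_le _ _).trans ?_
    linarith
  have hdc : euc (fun i => A' i j - A i j) ≤ τ := by
    refine le_trans ?_ hMδ
    have := euc_le_of_abs_le (x := fun i => A' i j - A i j) fun i => hAA i j
    rwa [Fintype.card_fin] at this
  have hsplit : resCorr y' A' x' j - resCorr y A x j =
      (y' - A' *ᵥ x') ⬝ᵥ (fun i => A' i j - A i j) +
        ((y' - A' *ᵥ x') - (y - A *ᵥ x)) ⬝ᵥ (fun i => A i j) := by
    simp only [resCorr, vecMul, dotProduct, Pi.sub_apply]
    rw [← Finset.sum_sub_distrib, ← Finset.sum_add_distrib]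
    exact Finset.sum_congr rfl fun i _ => by ring
  rw [hsplit]
  refine (abs_add_le _ _).trans ((add_le_add (abs_dotProduct_le _ _) (abs_dotProduct_le _ _)).trans
    ?_)
  have h1 := mul_le_mul hr'n hdc (euc_nonneg _) (by linarith)
  have h2 := mul_le_mul hdr (hcol j) (euc_nonneg _) (by positivity)
  have h3 : τ * α * 1 ≤ τ * α * α := mul_le_mul_of_nonneg_left hα1 (by positivity)
  nlinarith

/-- Under the regularity conditions of this lemma the LASSO support does not change under small
perturbations of the data. -/
theorem supp_eq_of_perturbation {m N : ℕ} {lam α τ δ ρ : ℝ} (hlam : 0 < lam) {y y' : Fin m → ℝ}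
    {A A' : Matrix (Fin m) (Fin N) ℝ} {S : Finset (Fin N)} (hm : 1 ≤ m)
    (hN : 1 ≤ N) (hδ : 0 ≤ δ) (hα : 3 * √(m : ℝ) ≤ α)
    (hτ : √((m : ℝ) * N) * δ = τ) (hτ' : τ ≤ 1 / 100) (hτρ : 10 * τ * α ^ 2 ≤ ρ)
    (hρ : ρ ≤ lam / 16)
    (hA : ∀ z : Fin N → ℝ, (∀ j ∉ S, z j = 0) → (m : ℝ) / 3 * euc z ^ 2 ≤ euc (A *ᵥ z) ^ 2)
    (hcol : ∀ j, euc (fun i => A i j) ≤ α) (hy : euc y ≤ α)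
    (hdual : ∀ x ∈ restrictedSol lam y A S, ∀ j ∉ S, |resCorr y A x j| < 7 * lam / 16)
    (hgap : ∀ j ∈ S, ∀ x ∈ restrictedSol lam y A (S.erase j), ρ < |(|resCorr y A x j| - lam / 2)|)
    (hyy : ∀ i, |y' i - y i| ≤ δ) (hAA : ∀ i j, |A' i j - A i j| ≤ δ) {x x' : Fin N → ℝ}
    (hx : x ∈ Sol lam y A) (hx' : x' ∈ Sol lam y' A') : supp x = supp x' := by
  have hinj : InjOnSupp A S := injOnSupp_of_euc_le (c := 7 / 4) hm fun z hz =>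
    (euc_mulVec_perturbed_ge hm hτ hτ' hA hAA hz).1
  have hinj' : InjOnSupp A' S := injOnSupp_of_euc_le (c := 2) hm fun z hz =>
    (euc_mulVec_perturbed_ge hm hτ hτ' hA hAA hz).2
  have hclose : ∀ T ⊆ S, ∀ z ∈ restrictedSol lam y A T, ∀ z' ∈ restrictedSol lam y' A' T,
      ∀ j, |resCorr y' A' z' j - resCorr y A z j| ≤ ρ := fun T hT z hz z' hz' j =>
    (abs_resCorr_sub_le hlam.le hT hm hN hδ hα hτ hτ' hA hcol hy hyy hAA hz hz' j).trans hτρ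
  have hxS : x ∈ restrictedSol lam y A S := mem_restrictedSol_of_mem_Sol hlam
    (fun z hz j hj => (hdual z hz j hj).trans (by linarith)) hx
  have hxS' : x' ∈ restrictedSol lam y' A' S := by
    refine mem_restrictedSol_of_mem_Sol hlam (fun z' hz' j hj => ?_) hx'
    have h1 := hclose S subset_rfl x hxS z' hz' j
    have h2 := hdual x hxS j hj
    have h3 := abs_sub_abs_le_abs_sub (resCorr y' A' z' j) (resCorr y A x j)
    linarith
  ext j
  change x j ≠ 0 ↔ x' j ≠ 0
  by_cases hj : j ∈ S
  · obtain ⟨u, hu⟩ := restrictedSol_nonempty hlam y A (S.erase j)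
    obtain ⟨u', hu'⟩ := restrictedSol_nonempty hlam y' A' (S.erase j)
    rw [coord_ne_zero_iff_of_erase hlam.le hinj hxS hj hu,
      coord_ne_zero_iff_of_erase hlam.le hinj' hxS' hj hu']
    have h1 := hclose _ (Finset.erase_subset j S) u hu u' hu' j
    have h2 := hgap j hj u hu
    have h3 := (abs_abs_sub_abs_le (resCorr y' A' u' j) (resCorr y A u j)).trans h1
    rw [abs_le] at h3
    rw [lt_abs] at h2
    constructor
    · intro h
      rcases h2 with h2 | h2 <;> linarith
    · intro h
      rcases h2 with h2 | h2 <;> linarith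
  · simp [hxS.1 j hj, hxS'.1 j hj]

theorem eq_zero_of_mem_Sol_zero {m N : ℕ} {lam : ℝ} (hlam : 0 < lam)
    {A : Matrix (Fin m) (Fin N) ℝ} {x : Fin N → ℝ} (hx : x ∈ Sol lam 0 A) : x = 0 := by
  have h := hx 0
  have h0 : lassoObj lam 0 A 0 = 0 := by simp [lassoObj]
  rw [h0] at h
  unfold lassoObj at h
  have h1 : 0 ≤ ∑ i, (A.mulVec x i - (0 : Fin m → ℝ) i) ^ 2 := by positivity
  have h2 : 0 ≤ ∑ j, |x j| := by positivity
  have h3 : ∑ j, |x j| = 0 := by nlinarith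
  ext j
  exact abs_eq_zero.1
    ((Finset.sum_eq_zero_iff_of_nonneg fun _ _ => abs_nonneg _).1 h3 j (Finset.mem_univ j))

theorem exists_supp_ne {m N : ℕ} {lam : ℝ} (hlam : 0 < lam) (hm : 1 ≤ m) (hN : 1 ≤ N)
    (x : Fin N → ℝ) : ∃ (y' : Fin m → ℝ) (A' : Matrix (Fin m) (Fin N) ℝ) (x' : Fin N → ℝ),
      x' ∈ Sol lam y' A' ∧ supp x ≠ supp x' := by
  by_cases hx : supp x = ∅
  · set A' : Matrix (Fin m) (Fin N) ℝ := fun _ _ => 1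
    set y' : Fin m → ℝ := fun _ => lam
    obtain ⟨x', hx'⟩ := restrictedSol_nonempty hlam y' A' Finset.univ
    refine ⟨y', A', x', restrictedSol_univ lam y' A' ▸ hx', fun h => ?_⟩
    rw [hx] at h
    have h0 : x' = 0 := by
      ext j
      by_contra hne
      exact (h ▸ (show j ∈ supp x' from hne) : j ∈ (∅ : Set (Fin N)))
    have h1 := abs_resCorr_le hlam.le hx' (Finset.mem_univ (⟨0, hN⟩ : Fin N))
    rw [h0, resCorr, mulVec_zero, sub_zero] at h1
    have h2 : vecMul y' A' ⟨0, hN⟩ = m * lam := by simp [vecMul, dotProduct, y', A']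
    rw [h2] at h1
    have h3 := (le_abs_self _).trans h1
    have h4 : (1 : ℝ) ≤ m := by exact_mod_cast hm
    nlinarith
  · obtain ⟨x', hx'⟩ := restrictedSol_nonempty hlam (0 : Fin m → ℝ)
      (0 : Matrix (Fin m) (Fin N) ℝ) Finset.univ
    rw [restrictedSol_univ] at hx'
    refine ⟨0, 0, x', hx', fun h => hx ?_⟩
    rw [h, eq_zero_of_mem_Sol_zero hlam hx']
    simp [supp]

theorem le_stsp {m N : ℕ} {lam d : ℝ} (hlam : 0 < lam) (hm : 1 ≤ m) (hN : 1 ≤ N)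
    {y : Fin m → ℝ} {A : Matrix (Fin m) (Fin N) ℝ}
    (h : ∀ δ y' A' x x', 0 ≤ δ → δ ≤ d → x ∈ Sol lam y A → x' ∈ Sol lam y' A' →
      (∀ i, |y' i - y i| ≤ δ) → (∀ i j, |A' i j - A i j| ≤ δ) → supp x = supp x') :
    d ≤ stsp lam y A := by
  refine le_csInf ?_ ?_
  · obtain ⟨x, hx⟩ := restrictedSol_nonempty hlam y A Finset.univ
    rw [restrictedSol_univ] at hx
    obtain ⟨y', A', x', hx', hne⟩ := exists_supp_ne hlam hm hN x
    refine ⟨∑ i, |y' i - y i| + ∑ i, ∑ j, |A' i j - A i j|, by positivity, y', A', x, x', hx, hx',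
      fun i => ?_, fun i j => ?_, hne⟩
    · have h1 := Finset.single_le_sum (f := fun i => |y' i - y i|) (fun _ _ => abs_nonneg _)
        (Finset.mem_univ i)
      have h2 : 0 ≤ ∑ i, ∑ j, |A' i j - A i j| := by positivity
      exact h1.trans (by linarith)
    · have h1 := Finset.single_le_sum (f := fun j => |A' i j - A i j|) (fun _ _ => abs_nonneg _)
        (Finset.mem_univ j)
      have h2 := Finset.single_le_sum (f := fun i => ∑ j, |A' i j - A i j|)
        (fun _ _ => Finset.sum_nonneg fun _ _ => abs_nonneg _) (Finset.mem_univ i)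
      have h3 : 0 ≤ ∑ i, |y' i - y i| := by positivity
      exact h1.trans (h2.trans (by linarith))
  · rintro δ ⟨hδ, y', A', x, x', hx, hx', hyy, hAA, hne⟩
    by_contra! hlt
    exact hne (h δ y' A' x x' hδ hlt.le hx hx' hyy hAA)

theorem condUL_lt_of_stable {m N : ℕ} {lam α σ : ℝ} (hlam : 0 < lam)
    {y : Fin m → ℝ} {A : Matrix (Fin m) (Fin N) ℝ} {S : Finset (Fin N)} (hm : 1 ≤ m)
    (hN : 1 ≤ N) (hα : 3 * √(m : ℝ) ≤ α) (hσ : 0 < σ) (hσ1 : σ ≤ 1 / 4) (hσlam : σ ≤ lam / 4)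
    (hA : ∀ z : Fin N → ℝ, (∀ j ∉ S, z j = 0) → (m : ℝ) / 3 * euc z ^ 2 ≤ euc (A *ᵥ z) ^ 2)
    (hcol : ∀ j, euc (fun i => A i j) ≤ α) (hy : euc y ≤ α)
    (hdual : ∀ x ∈ restrictedSol lam y A S, ∀ j ∉ S, |resCorr y A x j| < 7 * lam / 16)
    (hgap : ∀ j ∈ S, ∀ x ∈ restrictedSol lam y A (S.erase j),
      σ ^ 2 / (2 * α ^ 3) < |(|resCorr y A x j| - lam / 2)|) :
    condUL lam y A < ENNReal.ofReal (√((m : ℝ) * N) *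
      max (qpoly N lam α σ / σ ^ 2) (max (6 * α / √σ) 1)) := by
  have hM : 1 ≤ √(m : ℝ) := Real.one_le_sqrt.2 (by exact_mod_cast hm)
  have hα3 : 3 ≤ α := by linarith
  have hmN : 0 < √((m : ℝ) * N) := by
    refine Real.sqrt_pos.2 ?_
    have h1 : (0 : ℝ) < m := by exact_mod_cast hm
    have h2 : (0 : ℝ) < N := by exact_mod_cast hN
    positivity
  set d := σ ^ 2 / (48 * α ^ 5) / √((m : ℝ) * N) with hd
  have hd0 : 0 < d := by positivity
  have hdR : √((m : ℝ) * N) * d = σ ^ 2 / (48 * α ^ 5) := by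
    rw [hd]
    field_simp
  have hα2 : 9 ≤ α ^ 2 := by nlinarith
  have hα33 : 27 ≤ α ^ 3 := by
    have : α ^ 3 = α * α ^ 2 := by ring
    nlinarith
  have hα5 : 1 ≤ α ^ 5 := one_le_pow₀ (by linarith)
  have hst : d ≤ stsp lam y A := by
    refine le_stsp hlam hm hN fun δ y' A' x x' hδ hδd hx hx' hyy hAA => ?_
    have hτ : √((m : ℝ) * N) * δ ≤ σ ^ 2 / (48 * α ^ 5) := by
      rw [← hdR]
      exact mul_le_mul_of_nonneg_left hδd hmN.le
    refine supp_eq_of_perturbation (ρ := σ ^ 2 / (2 * α ^ 3)) hlam hm hN hδ hα rfl ?_ ?_ ?_ hA hcol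
      hy hdual hgap hyy hAA hx hx'
    · refine hτ.trans ?_
      rw [div_le_iff₀ (by positivity)]
      nlinarith
    · have h1 : 10 * (√((m : ℝ) * N) * δ) * α ^ 2 ≤ 10 * (σ ^ 2 / (48 * α ^ 5)) * α ^ 2 := by
        gcongr
      refine h1.trans ?_
      have h2 : 10 * (σ ^ 2 / (48 * α ^ 5)) * α ^ 2 = σ ^ 2 / (2 * α ^ 3) * (10 / 24) := by
        field_simp
        norm_num
      rw [h2]
      have : 0 ≤ σ ^ 2 / (2 * α ^ 3) := by positivity
      linarith
    · rw [div_le_iff₀ (by positivity)]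
      nlinarith
  have hne : stsp lam y A ≠ 0 := (hd0.trans_le hst).ne'
  rw [condUL, if_neg hne]
  refine (ENNReal.ofReal_lt_ofReal_iff (by positivity)).2 ?_
  have h1 : 1 / stsp lam y A ≤ 1 / d := one_div_le_one_div_of_le hd0 hst
  have h2 : 1 / d = √((m : ℝ) * N) * (48 * α ^ 5 / σ ^ 2) := by
    rw [hd]
    field_simp
  have h3 : 48 * α ^ 5 / σ ^ 2 < qpoly N lam α σ / σ ^ 2 := by
    refine div_lt_div_of_pos_right ?_ (by positivity)
    have h4 : 0 ≤ 12 * α ^ 3 * (1 + lam * √N) * √σ := by positivity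
    have h5 : 0 ≤ σ * (2 * α ^ 3 / lam + 3 * α) := by positivity
    rw [qpoly]
    linarith
  rw [h2] at h1
  exact h1.trans_lt (mul_lt_mul_of_pos_left (h3.trans_le (le_max_left _ _)) hmN)

theorem exists_half_net (E : Type*) [NormedAddCommGroup E] [NormedSpace ℝ E]
    [FiniteDimensional ℝ E] : ∃ F : Finset E, F.card ≤ 5 ^ Module.finrank ℝ E ∧
      ∀ x : E, ‖x‖ ≤ 1 → ∃ c ∈ F, ‖x - c‖ ≤ 1 / 2 := by
  classical
  set P : ℕ → Prop := fun k => ∃ s : Finset E, s.card = k ∧ (∀ c ∈ s, ‖c‖ ≤ 2) ∧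
    ∀ c ∈ s, ∀ d ∈ s, c ≠ d → 1 ≤ ‖c - d‖
  have hP0 : P 0 := ⟨∅, by simp⟩
  obtain ⟨s, hcard, hs2, hsep⟩ :=
    Nat.findGreatest_spec (P := P) (Nat.zero_le (5 ^ Module.finrank ℝ E)) hP0
  refine ⟨s.image fun c => (1 / 2 : ℝ) • c,
    Finset.card_image_le.trans (Besicovitch.card_le_of_separated s hs2 hsep), fun x hx => ?_⟩
  have hx2 : ‖(2 : ℝ) • x‖ ≤ 2 := by
    rw [norm_smul]
    norm_num
    linarith
  have key : ∃ c ∈ s, ‖(2 : ℝ) • x - c‖ ≤ 1 := by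
    by_contra! hcon
    have hxs : (2 : ℝ) • x ∉ s := fun h => by simpa using (hcon _ h).trans_le' zero_le_one |>.ne
    have hs2' : ∀ c ∈ insert ((2 : ℝ) • x) s, ‖c‖ ≤ 2 := by
      intro c hc
      rcases Finset.mem_insert.1 hc with rfl | hc
      · exact hx2
      · exact hs2 c hc
    have hsep' : ∀ c ∈ insert ((2 : ℝ) • x) s, ∀ d ∈ insert ((2 : ℝ) • x) s, c ≠ d →
        1 ≤ ‖c - d‖ := by
      intro c hc d hd hcd
      rcases Finset.mem_insert.1 hc with rfl | hc <;> rcases Finset.mem_insert.1 hd with rfl | hd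
      · exact absurd rfl hcd
      · exact (hcon d hd).le
      · rw [norm_sub_rev]
        exact (hcon c hc).le
      · exact hsep c hc d hd hcd
    have hle := Besicovitch.card_le_of_separated _ hs2' hsep'
    have hP : P (insert ((2 : ℝ) • x) s).card := ⟨_, rfl, hs2', hsep'⟩
    have := Nat.le_findGreatest hle hP
    rw [Finset.card_insert_of_notMem hxs, hcard] at this
    omega
  obtain ⟨c, hc, hcx⟩ := key
  refine ⟨(1 / 2 : ℝ) • c, Finset.mem_image_of_mem _ hc, ?_⟩
  have : x - (1 / 2 : ℝ) • c = (1 / 2 : ℝ) • ((2 : ℝ) • x - c) := by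
    rw [smul_sub, smul_smul]
    norm_num
  rw [this, norm_smul]
  norm_num
  linarith

theorem exists_pow_net (E : Type*) [NormedAddCommGroup E] [NormedSpace ℝ E]
    [FiniteDimensional ℝ E] (k : ℕ) : ∃ F : Finset E, F.card ≤ 5 ^ (Module.finrank ℝ E * k) ∧
      ∀ x : E, ‖x‖ ≤ 1 → ∃ c ∈ F, ‖x - c‖ ≤ (1 / 2) ^ k := by
  classical
  obtain ⟨G, hG, hGn⟩ := exists_half_net E
  induction k with
  | zero => exact ⟨{0}, by simp, fun x hx => ⟨0, by simp, by simpa using hx⟩⟩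
  | succ k ih =>
    obtain ⟨F, hF, hFn⟩ := ih
    refine ⟨Finset.image₂ (fun c d => c + (1 / 2 : ℝ) ^ k • d) F G, ?_, fun x hx => ?_⟩
    · refine (Finset.card_image₂_le _ _ _).trans ?_
      rw [mul_add, mul_one, pow_add]
      exact Nat.mul_le_mul hF hG
    · obtain ⟨c, hc, hcx⟩ := hFn x hx
      obtain ⟨d, hd, hdx⟩ := hGn ((2 : ℝ) ^ k • (x - c)) (by
        rw [norm_smul, norm_pow, Real.norm_ofNat]
        calc (2 : ℝ) ^ k * ‖x - c‖ ≤ 2 ^ k * (1 / 2) ^ k := by gcongr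
          _ = 1 := by rw [← mul_pow]; norm_num)
      refine ⟨_, Finset.mem_image₂_of_mem hc hd, ?_⟩
      have : x - (c + (1 / 2 : ℝ) ^ k • d) = (1 / 2 : ℝ) ^ k • ((2 : ℝ) ^ k • (x - c) - d) := by
        rw [smul_sub, smul_smul, ← mul_pow]
        norm_num
        abel
      rw [this, norm_smul, norm_pow, pow_succ]
      have h2 : ‖(1 / 2 : ℝ)‖ = 1 / 2 := by norm_num
      rw [h2]
      gcongr

theorem exists_supported_net {N : ℕ} (S : Finset (Fin N)) :
    ∃ F : Finset (Fin N → ℝ), F.card ≤ 5 ^ (5 * S.card) ∧ (∀ n ∈ F, ∀ j ∉ S, n j = 0) ∧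
      ∀ z : Fin N → ℝ, (∀ j ∉ S, z j = 0) → euc z ≤ 1 → ∃ n ∈ F, euc (z - n) ≤ 1 / 32 := by
  classical
  obtain ⟨G, hG, hGn⟩ := exists_pow_net (EuclideanSpace ℝ S) 5
  set pad : EuclideanSpace ℝ S → Fin N → ℝ := fun c j => if h : j ∈ S then c ⟨j, h⟩ else 0 with hpad
  have hnorm : ∀ (z : Fin N → ℝ) (c : EuclideanSpace ℝ S), (∀ j ∉ S, z j = 0) →
      ‖WithLp.toLp 2 (fun j : S => z j) - c‖ = euc (z - pad c) := fun z c hz => by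
    rw [EuclideanSpace.norm_eq, euc_eq_sqrt]
    congr 1
    rw [← Finset.sum_subset (Finset.subset_univ S), ← Finset.sum_coe_sort S]
    · refine Finset.sum_congr rfl fun j _ => ?_
      simp [hpad]
    · intro j _ hj
      simp [hpad, hj, hz j hj]
  refine ⟨G.image pad, Finset.card_image_le.trans ?_, ?_, fun z hz hz1 => ?_⟩
  · simpa [mul_comm] using hG
  · intro n hn j hj
    obtain ⟨c, _, rfl⟩ := Finset.mem_image.1 hn
    simp [hpad, hj]
  · have h0 := hnorm z 0 hz
    have he0 : pad 0 = 0 := by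
      ext j
      simp [hpad]
    rw [sub_zero, he0, sub_zero] at h0
    obtain ⟨c, hc, hcx⟩ := hGn (WithLp.toLp 2 fun j : S => z j) (by rw [h0]; exact hz1)
    refine ⟨pad c, Finset.mem_image_of_mem _ hc, ?_⟩
    rw [← hnorm z c hz]
    norm_num at hcx ⊢
    exact hcx

theorem euc_mulVec_ge_of_net {m N : ℕ} {A : Matrix (Fin m) (Fin N) ℝ} {S : Finset (Fin N)}
    {F : Finset (Fin N → ℝ)} (hFS : ∀ n ∈ F, ∀ j ∉ S, n j = 0)
    (hF : ∀ z : Fin N → ℝ, (∀ j ∉ S, z j = 0) → euc z ≤ 1 → ∃ n ∈ F, euc (z - n) ≤ 1 / 32)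
    (hlow : ∀ n ∈ F, (m : ℝ) / 2 * euc n ^ 2 ≤ euc (A *ᵥ n) ^ 2)
    (hup : ∀ n ∈ F, euc (A *ᵥ n) ^ 2 ≤ 2 * m * euc n ^ 2) {z : Fin N → ℝ}
    (hz : ∀ j ∉ S, z j = 0) : (m : ℝ) / 3 * euc z ^ 2 ≤ euc (A *ᵥ z) ^ 2 := by
  set M := √(m : ℝ) with hMdef
  have hM2 : M ^ 2 = m := Real.sq_sqrt (Nat.cast_nonneg m)
  have hM0 : 0 ≤ M := Real.sqrt_nonneg _
  have hup' : ∀ n ∈ F, euc (A *ᵥ n) ≤ 142 / 100 * M * euc n := fun n hn => by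
    refine le_of_sq_le_sq ?_ (by have := euc_nonneg n; positivity)
    rw [mul_pow, mul_pow, hM2]
    have h1 : 0 ≤ (m : ℝ) * euc n ^ 2 := by positivity
    linarith [hup n hn]
  have hlow' : ∀ n ∈ F, 7 / 10 * M * euc n ≤ euc (A *ᵥ n) := fun n hn => by
    refine le_of_sq_le_sq ?_ (euc_nonneg _)
    rw [mul_pow, mul_pow, hM2]
    have h1 : 0 ≤ (m : ℝ) * euc n ^ 2 := by positivity
    linarith [hlow n hn]
  set K : Set (Fin N → ℝ) := {z | euc z ≤ 1} ∩ {z | ∀ j ∉ S, z j = 0} with hK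
  have hKc : IsCompact K := by
    refine Metric.isCompact_of_isClosed_isBounded (IsClosed.inter ?_ ?_) ?_
    · exact isClosed_le continuous_euc continuous_const
    · simp only [Set.ofPred_forall]
      exact isClosed_iInter fun j => isClosed_iInter fun _ =>
        isClosed_eq (by fun_prop) (by fun_prop)
    · refine Metric.isBounded_closedBall (x := (0 : Fin N → ℝ)) (r := 1) |>.subset ?_
      rintro z ⟨hz1, _⟩
      rw [mem_closedBall_zero_iff, pi_norm_le_iff_of_nonneg zero_le_one]
      intro j
      refine le_trans ?_ hz1
      simpa [euc] using PiLp.norm_apply_le (WithLp.toLp 2 z) j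
  obtain ⟨z₀, hz₀, hmax⟩ := hKc.exists_isMaxOn ⟨0, by simp [hK, euc_zero]⟩
    (f := fun z => euc (A *ᵥ z)) (continuous_euc.comp (by fun_prop)).continuousOn
  set C := euc (A *ᵥ z₀) with hC
  have hCle : ∀ z ∈ K, euc (A *ᵥ z) ≤ C := fun z hz => hmax hz
  have hsc : ∀ z : Fin N → ℝ, (∀ j ∉ S, z j = 0) → euc z ≤ 1 / 32 → euc (A *ᵥ z) ≤ C / 32 := by
    intro z hzS hz32
    have h1 := hCle ((32 : ℝ) • z) ⟨by
      change euc _ ≤ 1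
      rw [euc_smul]
      norm_num
      linarith, fun j hj => by simp [hzS j hj]⟩
    rw [mulVec_smul, euc_smul] at h1
    norm_num at h1
    linarith
  have hstep : ∀ z ∈ K, ∃ n ∈ F, euc (z - n) ≤ 1 / 32 ∧ euc (A *ᵥ (z - n)) ≤ C / 32 := by
    intro z hz
    obtain ⟨n, hn, hzn⟩ := hF z hz.2 hz.1
    exact ⟨n, hn, hzn, hsc _ (fun j hj => by simp [hz.2 j hj, hFS n hn j hj]) hzn⟩
  have hCb : C ≤ 142 / 100 * M * (33 / 31) := by
    obtain ⟨n, hn, h1, h2⟩ := hstep z₀ hz₀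
    have h3 : euc n ≤ 33 / 32 := by
      have : n = z₀ - (z₀ - n) := by abel
      rw [this]
      have := euc_sub_le z₀ (z₀ - n)
      have := hz₀.1
      change euc z₀ ≤ 1 at this
      linarith
    have h4 : C ≤ euc (A *ᵥ n) + euc (A *ᵥ (z₀ - n)) := by
      have : A *ᵥ z₀ = A *ᵥ n + A *ᵥ (z₀ - n) := by
        rw [← mulVec_add]
        congr 1
        abel
      rw [hC, this]
      exact euc_add_le _ _
    have h5 := hup' n hn
    have h6 : 142 / 100 * M * euc n ≤ 142 / 100 * M * (33 / 32) := by gcongr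
    linarith
  have hunit : ∀ z : Fin N → ℝ, (∀ j ∉ S, z j = 0) → euc z = 1 → 6 / 10 * M ≤ euc (A *ᵥ z) := by
    intro z hzS hz1
    obtain ⟨n, hn, h1, h2⟩ := hstep z ⟨hz1.le, hzS⟩
    have h3 : 31 / 32 ≤ euc n := by
      have h4 : z = n + (z - n) := by abel
      have h5 := euc_add_le n (z - n)
      rw [← h4, hz1] at h5
      linarith
    have h4 : euc (A *ᵥ n) ≤ euc (A *ᵥ z) + euc (A *ᵥ (z - n)) := by
      have : A *ᵥ n = A *ᵥ z - A *ᵥ (z - n) := by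
        rw [← mulVec_sub]
        congr 1
        abel
      rw [this]
      exact euc_sub_le _ _
    have h5 := hlow' n hn
    have h6 : 7 / 10 * M * (31 / 32) ≤ 7 / 10 * M * euc n := by gcongr
    linarith
  rcases (euc_nonneg z).eq_or_lt with h0 | hpos
  · rw [← h0]
    simpa using sq_nonneg _
  · have h1 := hunit ((euc z)⁻¹ • z) (fun j hj => by simp [hz j hj]) (by
      rw [euc_smul, abs_of_pos (inv_pos.2 hpos), inv_mul_cancel₀ hpos.ne'])
    rw [mulVec_smul, euc_smul, abs_of_pos (inv_pos.2 hpos), inv_mul_eq_div, le_div_iff₀ hpos] at h1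
    have h2 := pow_le_pow_left₀ (by positivity) h1 2
    rw [mul_pow, mul_pow, hM2] at h2
    have h3 : 0 ≤ (m : ℝ) * euc z ^ 2 := by positivity
    linarith

/-- The matrix with entries `X (i, j)`. -/
def toMat {m N : ℕ} (X : Fin m × Fin N → ℝ) : Matrix (Fin m) (Fin N) ℝ :=
  Matrix.of fun i j => X (i, j)

theorem continuous_toMat {m N : ℕ} : Continuous (toMat : (Fin m × Fin N → ℝ) → _) := by
  unfold toMat
  fun_prop

theorem stdG_map_toMat_mulVec {m N : ℕ} {n : Fin N → ℝ} (hn : euc n = 1) :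
    (stdG (Fin m × Fin N)).map (fun X => toMat X *ᵥ n) = stdG (Fin m) := by
  set L : Matrix (Fin m) (Fin m × Fin N) ℝ := Matrix.of fun i p => if i = p.1 then n p.2 else 0
    with hLdef
  have hn2 : ∑ j, n j * n j = 1 := by
    have := euc_sq_eq_dotProduct n
    rw [hn, one_pow, dotProduct] at this
    exact this.symm
  have hL : L * L.transpose = 1 := by
    ext i k
    rw [Matrix.mul_apply, Fintype.sum_prod_type, Matrix.one_apply]
    simp only [hLdef, transpose_apply, of_apply, ite_mul, zero_mul, mul_ite, mul_zero]
    by_cases hik : i = k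
    · subst hik
      simp [hn2]
    · simp [hik]
  have : (fun X : Fin m × Fin N → ℝ => toMat X *ᵥ n) = L.mulVec := by
    ext X i
    simp only [toMat, mulVec, dotProduct, hLdef, of_apply, Fintype.sum_prod_type, ite_mul, zero_mul]
    simp [mul_comm]
  rw [this, stdG_map_mulVec L hL]

theorem stdG_mulVec_unit {m N : ℕ} {n : Fin N → ℝ} (hn : n ≠ 0) {s : Set ℝ}
    (hs : MeasurableSet s) :
    stdG (Fin m × Fin N) {X | euc (toMat X *ᵥ n) ^ 2 / euc n ^ 2 ∈ s} =
      stdG (Fin m) {x | ∑ i, x i ^ 2 ∈ s} := by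
  have hpos : 0 < euc n := (euc_nonneg n).lt_of_ne' (mt euc_eq_zero.1 hn)
  have h1 : euc ((euc n)⁻¹ • n) = 1 := by
    rw [euc_smul, abs_of_pos (inv_pos.2 hpos), inv_mul_cancel₀ hpos.ne']
  have hmeas : Measurable fun x : Fin m → ℝ => ∑ i, x i ^ 2 := by fun_prop
  change _ = stdG (Fin m) ((fun x : Fin m → ℝ => ∑ i, x i ^ 2) ⁻¹' s)
  rw [← stdG_map_toMat_mulVec h1, Measure.map_apply _ (hmeas hs)]
  · congr 1
    ext X
    simp only [mem_preimage, mem_ofPred_eq]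
    rw [← euc_sq, mulVec_smul, euc_smul, abs_of_pos (inv_pos.2 hpos), mul_pow, inv_pow,
      inv_mul_eq_div]
  · have : Continuous fun X : Fin m × Fin N → ℝ => toMat X *ᵥ ((euc n)⁻¹ • n) := by
      have := continuous_toMat (m := m) (N := N)
      fun_prop
    exact this.measurable

theorem sqrt_two_pow_le (m : ℕ) : √2 ^ m ≤ exp (11 / 24 * m) := by
  have h : √2 ≤ exp (11 / 24) := by
    rw [Real.sqrt_le_left (exp_pos _).le, ← exp_nat_mul]
    have h1 : (2 : ℝ) ^ 12 ≤ exp (11 / 12) ^ 12 := by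
      rw [← exp_nat_mul]
      have : ((12 : ℕ) : ℝ) * (11 / 12) = (11 : ℕ) * 1 := by norm_num
      rw [this, exp_nat_mul]
      have := exp_one_gt_d9.le
      calc (2 : ℝ) ^ 12 ≤ 2.7182818283 ^ 11 := by norm_num
        _ ≤ _ := by gcongr
    have h2 := (pow_le_pow_iff_left₀ (by norm_num) (exp_pos _).le (by norm_num)).1 h1
    have h3 : ((2 : ℕ) : ℝ) * (11 / 24) = 11 / 12 := by norm_num
    rw [h3]
    exact h2
  calc √2 ^ m ≤ exp (11 / 24) ^ m := by gcongr
    _ = _ := by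
      rw [← exp_nat_mul]
      ring_nf

theorem sqrt_third_pow_le (m : ℕ) : √(1 / 3) ^ m ≤ exp (-(13 / 24) * m) := by
  have h : √(1 / 3) ≤ exp (-(13 / 24)) := by
    rw [Real.sqrt_le_left (exp_pos _).le, ← exp_nat_mul]
    have h1 : exp (13 / 12) ^ 12 ≤ (3 : ℝ) ^ 12 := by
      rw [← exp_nat_mul]
      have : ((12 : ℕ) : ℝ) * (13 / 12) = (13 : ℕ) * 1 := by norm_num
      rw [this, exp_nat_mul]
      have := exp_one_lt_d9.le
      calc exp 1 ^ 13 ≤ (2.7182818286 : ℝ) ^ 13 := by gcongr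
        _ ≤ _ := by norm_num
    have h2 := (pow_le_pow_iff_left₀ (exp_pos _).le (by norm_num) (by norm_num)).1 h1
    have h3 : ((2 : ℕ) : ℝ) * -(13 / 24) = -(13 / 12) := by norm_num
    rw [h3, exp_neg, one_div]
    exact inv_anti₀ (exp_pos _) h2
  calc √(1 / 3) ^ m ≤ exp (-(13 / 24)) ^ m := by gcongr
    _ = _ := by
      rw [← exp_nat_mul]
      ring_nf

theorem five_pow_le (s : ℕ) : ((5 ^ (5 * s) : ℕ) : ℝ) ≤ exp (9 * s) := by
  have h : (5 : ℝ) ^ 5 ≤ exp 9 := by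
    have h1 : exp 9 = exp 1 ^ 9 := by
      rw [← exp_nat_mul]
      norm_num
    have := exp_one_gt_d9.le
    rw [h1]
    calc (5 : ℝ) ^ 5 ≤ 2.7182818283 ^ 9 := by norm_num
      _ ≤ _ := by gcongr
  push_cast
  rw [pow_mul]
  calc ((5 : ℝ) ^ 5) ^ s ≤ exp 9 ^ s := by gcongr
    _ = _ := by
      rw [← exp_nat_mul]
      ring_nf

theorem stdG_mulVec_ge {m N : ℕ} {n : Fin N → ℝ} (hn : n ≠ 0) (r : ℝ) :
    stdG (Fin m × Fin N) {X | r * euc n ^ 2 ≤ euc (toMat X *ᵥ n) ^ 2} ≤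
      ENNReal.ofReal (exp (-r / 4 + 11 / 24 * m)) := by
  have hpos : 0 < euc n := (euc_nonneg n).lt_of_ne' (mt euc_eq_zero.1 hn)
  have h := stdG_mulVec_unit (m := m) hn (measurableSet_Ici (a := r))
  have hset : {X : Fin m × Fin N → ℝ | r * euc n ^ 2 ≤ euc (toMat X *ᵥ n) ^ 2} =
      {X | euc (toMat X *ᵥ n) ^ 2 / euc n ^ 2 ∈ Ici r} := by
    ext X
    simp only [mem_ofPred_eq, mem_Ici]
    rw [le_div_iff₀ (by positivity)]
  rw [hset, h]
  refine (stdG_sum_sq_ge r).trans (ENNReal.ofReal_le_ofReal ?_)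
  rw [Fintype.card_fin, exp_add]
  exact mul_le_mul_of_nonneg_left (sqrt_two_pow_le m) (exp_pos _).le

theorem stdG_mulVec_le {m N : ℕ} {n : Fin N → ℝ} (hn : n ≠ 0) (r : ℝ) :
    stdG (Fin m × Fin N) {X | euc (toMat X *ᵥ n) ^ 2 ≤ r * euc n ^ 2} ≤
      ENNReal.ofReal (exp (r - 13 / 24 * m)) := by
  have hpos : 0 < euc n := (euc_nonneg n).lt_of_ne' (mt euc_eq_zero.1 hn)
  have h := stdG_mulVec_unit (m := m) hn (measurableSet_Iic (a := r))
  have hset : {X : Fin m × Fin N → ℝ | euc (toMat X *ᵥ n) ^ 2 ≤ r * euc n ^ 2} =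
      {X | euc (toMat X *ᵥ n) ^ 2 / euc n ^ 2 ∈ Iic r} := by
    ext X
    simp only [mem_ofPred_eq, mem_Iic]
    rw [div_le_iff₀ (by positivity)]
  rw [hset, h]
  refine (stdG_sum_sq_le r).trans (ENNReal.ofReal_le_ofReal ?_)
  have : r - 13 / 24 * (m : ℝ) = r + -(13 / 24) * m := by ring
  rw [Fintype.card_fin, this, exp_add]
  exact mul_le_mul_of_nonneg_left (sqrt_third_pow_le m) (exp_pos _).le

theorem stdG_not_restricted_lower {m N : ℕ} (S : Finset (Fin N)) (hm : 256 * S.card ≤ m) :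
    stdG (Fin m × Fin N) {X | ¬ ∀ z : Fin N → ℝ, (∀ j ∉ S, z j = 0) →
      (m : ℝ) / 3 * euc z ^ 2 ≤ euc (toMat X *ᵥ z) ^ 2} ≤
      ENNReal.ofReal (2 * exp (-S.card)) := by
  obtain ⟨F, hFc, hFS, hF⟩ := exists_supported_net S
  set G := F.filter fun n => n ≠ 0 with hG
  have hsub : {X : Fin m × Fin N → ℝ | ¬ ∀ z : Fin N → ℝ, (∀ j ∉ S, z j = 0) →
      (m : ℝ) / 3 * euc z ^ 2 ≤ euc (toMat X *ᵥ z) ^ 2} ⊆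
      ⋃ n ∈ G, ({X | euc (toMat X *ᵥ n) ^ 2 ≤ (m / 2 : ℝ) * euc n ^ 2} ∪
        {X | (2 * m : ℝ) * euc n ^ 2 ≤ euc (toMat X *ᵥ n) ^ 2}) := by
    intro X hX
    by_contra hcon
    simp only [mem_iUnion, mem_union, mem_ofPred_eq, not_exists, not_or, not_le] at hcon
    refine hX fun z hz => euc_mulVec_ge_of_net hFS hF (fun n hn => ?_) (fun n hn => ?_) hz
    · by_cases h0 : n = 0
      · simp [h0, euc_zero]
      · exact (hcon n (Finset.mem_filter.2 ⟨hn, h0⟩)).1.le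
    · by_cases h0 : n = 0
      · simp [h0, euc_zero]
      · exact (hcon n (Finset.mem_filter.2 ⟨hn, h0⟩)).2.le
  refine (measure_mono hsub).trans ((measure_biUnion_finset_le _ _).trans ?_)
  have hone : ∀ n ∈ G, stdG (Fin m × Fin N)
      ({X | euc (toMat X *ᵥ n) ^ 2 ≤ (m / 2 : ℝ) * euc n ^ 2} ∪
        {X | (2 * m : ℝ) * euc n ^ 2 ≤ euc (toMat X *ᵥ n) ^ 2}) ≤
      ENNReal.ofReal (2 * exp (-(m / 24 : ℝ))) := fun n hn => by
    have h0 := (Finset.mem_filter.1 hn).2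
    refine (measure_union_le _ _).trans ((add_le_add (stdG_mulVec_le h0 _)
      (stdG_mulVec_ge h0 _)).trans_eq ?_)
    rw [← ENNReal.ofReal_add (exp_pos _).le (exp_pos _).le, two_mul]
    congr 3; ring_nf
  refine (Finset.sum_le_sum hone).trans ?_
  rw [Finset.sum_const, nsmul_eq_mul, ← ENNReal.ofReal_natCast, ← ENNReal.ofReal_mul (by positivity)]
  refine ENNReal.ofReal_le_ofReal ?_
  have h1 : (G.card : ℝ) ≤ exp (9 * S.card) := by
    refine le_trans ?_ (five_pow_le S.card)
    exact_mod_cast (Finset.card_filter_le _ _).trans hFc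
  have h2 : exp (9 * S.card : ℝ) * exp (-(m / 24 : ℝ)) ≤ exp (-S.card) := by
    rw [← exp_add, exp_le_exp]
    have : (256 * S.card : ℝ) ≤ m := by exact_mod_cast hm
    have h0 : (0 : ℝ) ≤ S.card := Nat.cast_nonneg _
    linarith
  have h3 := mul_le_mul_of_nonneg_right h1 (exp_pos (-(m / 24 : ℝ))).le
  linarith

theorem stdG_column_large {m N : ℕ} :
    stdG (Fin m × Fin N) {X | ∃ j, 3 * √(m : ℝ) + 6 * √(N : ℝ) < euc fun i => toMat X i j} ≤
      ENNReal.ofReal (exp (-m)) := by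
  have hsub : {X : Fin m × Fin N → ℝ | ∃ j, 3 * √(m : ℝ) + 6 * √(N : ℝ) < euc fun i => toMat X i j} ⊆
      ⋃ j ∈ (Finset.univ : Finset (Fin N)), {X | (9 * m + 36 * N : ℝ) *
        euc (Pi.single j 1 : Fin N → ℝ) ^ 2 ≤ euc (toMat X *ᵥ Pi.single j 1) ^ 2} := by
    rintro X ⟨j, hj⟩
    simp only [mem_iUnion]
    refine ⟨j, Finset.mem_univ j, ?_⟩
    have h1 : euc (Pi.single j 1 : Fin N → ℝ) ^ 2 = 1 := by
      rw [euc_sq, Finset.sum_eq_single j (fun k _ hk => by simp [hk]) (by simp)]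
      simp
    rw [mem_ofPred_eq, h1, mulVec_single_one]
    have h2 := pow_le_pow_left₀ (by positivity) hj.le 2
    refine le_trans ?_ h2
    have h3 : 0 ≤ √(m : ℝ) * √(N : ℝ) := by positivity
    nlinarith [Real.sq_sqrt (Nat.cast_nonneg (α := ℝ) m), Real.sq_sqrt (Nat.cast_nonneg (α := ℝ) N)]
  refine (measure_mono hsub).trans ((measure_biUnion_finset_le _ _).trans ?_)
  refine (Finset.sum_le_sum fun j _ => stdG_mulVec_ge (n := Pi.single j 1)
    (by simp) (9 * m + 36 * N : ℝ)).trans ?_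
  rw [Finset.sum_const, nsmul_eq_mul, ← ENNReal.ofReal_natCast, ← ENNReal.ofReal_mul (by positivity)]
  refine ENNReal.ofReal_le_ofReal ?_
  have h1 : ((Finset.univ : Finset (Fin N)).card : ℝ) ≤ exp N := by
    rw [Finset.card_univ, Fintype.card_fin]
    linarith [add_one_le_exp (N : ℝ)]
  calc _ ≤ exp N * exp (-(9 * m + 36 * N : ℝ) / 4 + 11 / 24 * m) :=
        mul_le_mul_of_nonneg_right h1 (exp_pos _).le
    _ ≤ exp (-m) := by
      rw [← exp_add, exp_le_exp]
      have h2 : (0 : ℝ) ≤ m := Nat.cast_nonneg _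
      have h3 : (0 : ℝ) ≤ N := Nat.cast_nonneg _
      linarith

theorem stdG_mulVec_large {m N : ℕ} (v : Fin N → ℝ) :
    stdG (Fin m × Fin N) {X | 5 / 2 * √(m : ℝ) * euc v < euc (toMat X *ᵥ v)} ≤
      ENNReal.ofReal (exp (-m)) := by
  by_cases hv : v = 0
  · simp [hv, euc_zero]
  · have hsub : {X : Fin m × Fin N → ℝ | 5 / 2 * √(m : ℝ) * euc v < euc (toMat X *ᵥ v)} ⊆
        {X | (25 / 4 * m : ℝ) * euc v ^ 2 ≤ euc (toMat X *ᵥ v) ^ 2} := by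
      intro X hX
      rw [mem_ofPred_eq] at hX ⊢
      have h2 := pow_le_pow_left₀ (by have := euc_nonneg v; positivity) hX.le 2
      rw [mul_pow, mul_pow, Real.sq_sqrt (Nat.cast_nonneg m)] at h2
      linarith
    refine (measure_mono hsub).trans ((stdG_mulVec_ge hv _).trans ?_)
    refine ENNReal.ofReal_le_ofReal (exp_le_exp.2 ?_)
    have h2 : (0 : ℝ) ≤ m := Nat.cast_nonneg _
    linarith

theorem stdG_euc_large (m : ℕ) :
    stdG (Fin m) {g | 2 * m < euc g ^ 2} ≤ ENNReal.ofReal (exp (-(m / 24))) := by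
  have hsub : {g : Fin m → ℝ | 2 * m < euc g ^ 2} ⊆ {g | 2 * m ≤ ∑ i, g i ^ 2} := fun g hg => by
    rw [mem_ofPred_eq] at hg ⊢
    rw [← euc_sq]
    exact hg.le
  refine (measure_mono hsub).trans ((stdG_sum_sq_ge _).trans (ENNReal.ofReal_le_ofReal ?_))
  rw [Fintype.card_fin]
  calc _ ≤ exp (-(2 * m) / 4) * exp (11 / 24 * m) :=
        mul_le_mul_of_nonneg_left (sqrt_two_pow_le m) (exp_pos _).le
    _ = _ := by
      rw [← exp_add]
      congr 1
      ring

theorem measurableSet_exists_of_isClosed {Y : Type*} [TopologicalSpace Y] [MeasurableSpace Y]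
    [OpensMeasurableSpace Y] {N : ℕ} {C : Set (Y × (Fin N → ℝ))} (hC : IsClosed C) :
    MeasurableSet {p | ∃ x, (p, x) ∈ C} := by
  have hk : ∀ k : ℕ, IsClosed {p | ∃ x ∈ Metric.closedBall (0 : Fin N → ℝ) k, (p, x) ∈ C} :=
    fun k => by
    have hcl : IsClosed {q : Y × Metric.closedBall (0 : Fin N → ℝ) k | (q.1, (q.2 : Fin N → ℝ)) ∈ C} :=
      hC.preimage (by fun_prop)
    have : CompactSpace (Metric.closedBall (0 : Fin N → ℝ) k) :=
      isCompact_iff_compactSpace.1 (isCompact_closedBall _ _)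
    convert isClosedMap_fst_of_compactSpace _ hcl using 1
    ext p
    simp
  have : {p | ∃ x, (p, x) ∈ C} =
      ⋃ k : ℕ, {p | ∃ x ∈ Metric.closedBall (0 : Fin N → ℝ) k, (p, x) ∈ C} := by
    ext p
    simp only [mem_ofPred_eq, mem_iUnion]
    constructor
    · rintro ⟨x, hx⟩
      obtain ⟨k, hk⟩ := exists_nat_ge ‖x‖
      exact ⟨k, x, by simpa using hk, hx⟩
    · rintro ⟨k, x, -, hx⟩
      exact ⟨x, hx⟩
  rw [this]
  exact MeasurableSet.iUnion fun k => (hk k).measurableSet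

/-- The noisy observation of `v` through the random matrix and noise `p`. -/
def obs {m N : ℕ} (v : Fin N → ℝ) (p : (Fin m × Fin N → ℝ) × (Fin m → ℝ)) : Fin m → ℝ :=
  toMat p.1 *ᵥ v + p.2

theorem continuous_obs {m N : ℕ} (v : Fin N → ℝ) :
    Continuous (obs v : (Fin m × Fin N → ℝ) × (Fin m → ℝ) → _) := by
  have := continuous_toMat (m := m) (N := N)
  unfold obs
  fun_prop

theorem isClosed_mem_restrictedSol {m N : ℕ} (lam : ℝ) (v : Fin N → ℝ) (T : Finset (Fin N)) :
    IsClosed {q : ((Fin m × Fin N → ℝ) × (Fin m → ℝ)) × (Fin N → ℝ) |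
      q.2 ∈ restrictedSol lam (obs v q.1) (toMat q.1.1) T} := by
  have h1 := continuous_obs (m := m) v
  have h2 := continuous_toMat (m := m) (N := N)
  have hobj : Continuous fun q : ((Fin m × Fin N → ℝ) × (Fin m → ℝ)) × (Fin N → ℝ) =>
      lassoObj lam (obs v q.1) (toMat q.1.1) q.2 := by
    unfold lassoObj
    fun_prop
  have hset : {q : ((Fin m × Fin N → ℝ) × (Fin m → ℝ)) × (Fin N → ℝ) |
      q.2 ∈ restrictedSol lam (obs v q.1) (toMat q.1.1) T} =
      (⋂ j : Fin N, ⋂ _ : j ∉ T, {q | q.2 j = 0}) ∩ ⋂ z : Fin N → ℝ, ⋂ _ : ∀ j ∉ T, z j = 0,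
        {q | lassoObj lam (obs v q.1) (toMat q.1.1) q.2 ≤
          lassoObj lam (obs v q.1) (toMat q.1.1) z} := by
    ext q
    simp [restrictedSol]
  rw [hset]
  have hcl : ∀ z : Fin N → ℝ, IsClosed {q : ((Fin m × Fin N → ℝ) × (Fin m → ℝ)) × (Fin N → ℝ) |
      lassoObj lam (obs v q.1) (toMat q.1.1) q.2 ≤ lassoObj lam (obs v q.1) (toMat q.1.1) z} :=
    fun z => by
    have hz : Continuous fun q : ((Fin m × Fin N → ℝ) × (Fin m → ℝ)) × (Fin N → ℝ) =>
        lassoObj lam (obs v q.1) (toMat q.1.1) z := by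
      unfold lassoObj
      fun_prop
    exact isClosed_le hobj hz
  have hcl0 : ∀ j, IsClosed {q : ((Fin m × Fin N → ℝ) × (Fin m → ℝ)) × (Fin N → ℝ) | q.2 j = 0} :=
    fun j => isClosed_eq (by fun_prop) continuous_const
  exact (isClosed_iInter fun j => isClosed_iInter fun _ => hcl0 j).inter
    (isClosed_iInter fun z => isClosed_iInter fun _ => hcl z)

theorem continuous_resCorr_obs {m N : ℕ} (v : Fin N → ℝ) (j : Fin N) :
    Continuous fun q : ((Fin m × Fin N → ℝ) × (Fin m → ℝ)) × (Fin N → ℝ) =>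
      resCorr (obs v q.1) (toMat q.1.1) q.2 j := by
  have h1 := continuous_obs (m := m) v
  have h2 := continuous_toMat (m := m) (N := N)
  unfold resCorr
  fun_prop

theorem toMat_setCol_mulVec {m N : ℕ} (j : Fin N) (X : Fin m × Fin N → ℝ) (c : Fin m → ℝ)
    (z : Fin N → ℝ) : toMat (setCol j X c) *ᵥ z = toMat (setCol j X 0) *ᵥ z + z j • c := by
  ext i
  simp only [mulVec, dotProduct, toMat, of_apply, setCol, Pi.add_apply, Pi.smul_apply, smul_eq_mul,
    Pi.zero_apply]
  rw [← Finset.add_sum_erase _ _ (Finset.mem_univ j), ← Finset.add_sum_erase _ _ (Finset.mem_univ j)]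
  simp only [if_true]
  rw [zero_mul, zero_add, add_comm, mul_comm]
  congr 1
  exact Finset.sum_congr rfl fun k hk => by simp [Finset.ne_of_mem_erase hk]

theorem restrictedSol_setCol {m N : ℕ} (lam : ℝ) (y : Fin m → ℝ) {j : Fin N} {T : Finset (Fin N)}
    (hj : j ∉ T) (X : Fin m × Fin N → ℝ) (c : Fin m → ℝ) :
    restrictedSol lam y (toMat (setCol j X c)) T =
      restrictedSol lam y (toMat (setCol j X 0)) T := by
  have h : ∀ z : Fin N → ℝ, (∀ k ∉ T, z k = 0) → lassoObj lam y (toMat (setCol j X c)) z =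
      lassoObj lam y (toMat (setCol j X 0)) z := fun z hz => by
    rw [lassoObj, lassoObj, toMat_setCol_mulVec, hz j hj, zero_smul, add_zero]
  ext x
  simp only [restrictedSol, mem_ofPred_eq]
  refine and_congr_right fun hx => forall_congr' fun z => forall_congr' fun hz => ?_
  rw [h x hx, h z hz]

theorem resCorr_setCol {m N : ℕ} (y : Fin m → ℝ) {j : Fin N} (X : Fin m × Fin N → ℝ)
    (c : Fin m → ℝ) {x : Fin N → ℝ} (hx : x j = 0) :
    resCorr y (toMat (setCol j X c)) x j = (y - toMat (setCol j X 0) *ᵥ x) ⬝ᵥ c := by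
  rw [resCorr, toMat_setCol_mulVec, hx, zero_smul, add_zero]
  simp [vecMul, toMat, setCol]

theorem stdG_dual_violation {m N : ℕ} {lam : ℝ} (hlam : 0 < lam) (v : Fin N → ℝ)
    (S : Finset (Fin N)) {j : Fin N} (hj : j ∉ S) (hv : v j = 0) {V : ℝ} (hV : 0 < V)
    (ρ : Measure (Fin m → ℝ)) [IsProbabilityMeasure ρ] :
    ((stdG (Fin m × Fin N)).prod ρ) {p | ∃ x ∈ restrictedSol lam (obs v p) (toMat p.1) S,
      euc (obs v p - toMat p.1 *ᵥ x) ^ 2 ≤ V ∧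
        7 * lam / 16 ≤ |resCorr (obs v p) (toMat p.1) x j|} ≤
      ENNReal.ofReal (2 * exp (-(7 * lam / 16) ^ 2 / (2 * V))) := by
  refine stdG_prod_le_of_setCol ρ j ?_ fun X w => ?_
  · have h1 := continuous_obs (m := m) v
    have h2 := continuous_toMat (m := m) (N := N)
    have h3 := continuous_euc (ι := Fin m)
    refine measurableSet_exists_of_isClosed (C := {q | q.2 ∈ restrictedSol lam (obs v q.1)
      (toMat q.1.1) S ∧ euc (obs v q.1 - toMat q.1.1 *ᵥ q.2) ^ 2 ≤ V ∧
        7 * lam / 16 ≤ |resCorr (obs v q.1) (toMat q.1.1) q.2 j|}) ?_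
    have h4 := continuous_resCorr_obs (m := m) v j
    exact (isClosed_mem_restrictedSol lam v S).inter ((isClosed_le
      ((h3.comp (by fun_prop)).pow 2) continuous_const).inter
      (isClosed_le continuous_const h4.abs))
  · set y := toMat (setCol j X 0) *ᵥ v + w with hy
    have hobs : ∀ c, obs v (setCol j X c, w) = y := fun c => by
      rw [obs, toMat_setCol_mulVec, hv, zero_smul, add_zero]
    obtain ⟨x₀, hx₀⟩ := restrictedSol_nonempty hlam y (toMat (setCol j X 0)) S
    set r := y - toMat (setCol j X 0) *ᵥ x₀ with hr
    have key : ∀ c, (setCol j X c, w) ∈ {p : (Fin m × Fin N → ℝ) × (Fin m → ℝ) |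
        ∃ x ∈ restrictedSol lam (obs v p) (toMat p.1) S,
        euc (obs v p - toMat p.1 *ᵥ x) ^ 2 ≤ V ∧
        7 * lam / 16 ≤ |resCorr (obs v p) (toMat p.1) x j|} →
        euc r ^ 2 ≤ V ∧ 7 * lam / 16 ≤ |∑ i, c i * r i| := fun c hc => by
      rw [mem_ofPred_eq] at hc
      obtain ⟨x, hx, h1, h2⟩ := hc
      simp only [hobs] at hx h1 h2
      rw [restrictedSol_setCol lam y hj] at hx
      have hxj := hx.1 j hj
      have hA := mulVec_eq_of_mem_restrictedSol hlam.le hx hx₀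
      rw [toMat_setCol_mulVec, hxj, zero_smul, add_zero, hA] at h1
      rw [resCorr_setCol y X c hxj, hA, dotProduct_comm] at h2
      exact ⟨h1, h2⟩
    by_cases hrV : euc r ^ 2 ≤ V
    · refine (measure_mono fun c hc => (key c hc).2).trans
        (stdG_abs_linear_ge r hV (by positivity) ?_)
      rwa [← euc_sq]
    · have : {c | (setCol j X c, w) ∈ {p : (Fin m × Fin N → ℝ) × (Fin m → ℝ) |
        ∃ x ∈ restrictedSol lam (obs v p) (toMat p.1) S,
        euc (obs v p - toMat p.1 *ᵥ x) ^ 2 ≤ V ∧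
        7 * lam / 16 ≤ |resCorr (obs v p) (toMat p.1) x j|}} = ∅ :=
        eq_empty_of_forall_notMem fun c hc => hrV (key c hc).1
      rw [this, measure_empty]
      exact zero_le

theorem gaussianReal_Icc_le (a l : ℝ) :
    gaussianReal 0 1 (Icc a (a + l)) ≤ ENNReal.ofReal l := by
  rw [gaussianReal_apply _ one_ne_zero]
  calc ∫⁻ x in Icc a (a + l), gaussianPDF 0 1 x ≤ ∫⁻ _ in Icc a (a + l), 1 := by
        refine lintegral_mono fun x => ?_
        rw [gaussianPDF, ENNReal.ofReal_le_one, gaussianPDFReal]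
        refine mul_le_one₀ (inv_le_one_of_one_le₀ ?_) (exp_pos _).le (exp_le_one_iff.2 ?_)
        · rw [Real.one_le_sqrt]
          have := Real.pi_gt_three
          simp
          linarith
        · simp only [NNReal.coe_one]
          have := sq_nonneg (x - 0)
          linarith
    _ = ENNReal.ofReal l := by simp

theorem gaussianReal_quadratic_le {a : ℝ} (ha : a ≠ 0) (b d : ℝ) {r : ℝ} (hr : 0 ≤ r) :
    gaussianReal 0 1 {t | |a * t ^ 2 + b * t + d| ≤ r} ≤
      ENNReal.ofReal (2 * √(2 * (r / |a|))) := by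
  have ha' : 0 < |a| := abs_pos.2 ha
  set κ := r / |a| with hκ
  have hκ0 : 0 ≤ κ := by positivity
  set h := b / (2 * a) with hh
  set k := d / a - h ^ 2 with hk
  have hsub : {t : ℝ | |a * t ^ 2 + b * t + d| ≤ r} ⊆
      Icc (√(-k - κ) - h) (√(-k - κ) - h + √(2 * κ)) ∪
      Icc (-√(-k - κ) - h - √(2 * κ)) (-√(-k - κ) - h - √(2 * κ) + √(2 * κ)) := by
    intro t ht
    rw [mem_ofPred_eq] at ht
    have h1 : a * t ^ 2 + b * t + d = a * ((t + h) ^ 2 + k) := by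
      rw [hk, hh]
      field_simp
      ring
    rw [h1, abs_mul, mul_comm, ← le_div_iff₀ ha', ← hκ, abs_le] at ht
    have hlow : √(-k - κ) ≤ |t + h| := by
      rw [Real.sqrt_le_left (abs_nonneg _), sq_abs]
      linarith
    have hup : |t + h| ≤ √(-k - κ) + √(2 * κ) := by
      refine abs_le_of_sq_le_sq ?_ (by positivity)
      have h3 : -k - κ ≤ √(-k - κ) ^ 2 := by
        rcases le_total 0 (-k - κ) with h0 | h0
        · rw [Real.sq_sqrt h0]
        · exact h0.trans (sq_nonneg _)
      have h4 := Real.sq_sqrt (by positivity : 0 ≤ 2 * κ)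
      have h5 : 0 ≤ √(-k - κ) * √(2 * κ) := by positivity
      nlinarith
    rcases abs_cases (t + h) with ⟨he, _⟩ | ⟨he, _⟩
    · left
      constructor <;> linarith
    · right
      constructor <;> linarith
  refine (measure_mono hsub).trans ((measure_union_le _ _).trans ?_)
  rw [two_mul √(2 * κ), ENNReal.ofReal_add (Real.sqrt_nonneg _) (Real.sqrt_nonneg _)]
  exact add_le_add (gaussianReal_Icc_le _ _)
    (gaussianReal_Icc_le _ _)

theorem restrictedSol_add_smul {m N : ℕ} (lam : ℝ) (y e : Fin m → ℝ) (A : Matrix (Fin m) (Fin N) ℝ)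
    {T : Finset (Fin N)} (he : ∀ z : Fin N → ℝ, (∀ k ∉ T, z k = 0) → e ⬝ᵥ (A *ᵥ z) = 0) (t : ℝ) :
    restrictedSol lam (y + t • e) A T = restrictedSol lam y A T := by
  have h : ∀ z : Fin N → ℝ, (∀ k ∉ T, z k = 0) → lassoObj lam (y + t • e) A z =
      lassoObj lam y A z + (2 * t * (e ⬝ᵥ y) + t ^ 2 * (e ⬝ᵥ e)) := fun z hz => by
    have h1 : y + t • e - A *ᵥ z = (y - A *ᵥ z) + t • e := by abel
    rw [lassoObj_eq_dotProduct, lassoObj_eq_dotProduct, h1]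
    simp only [add_dotProduct, dotProduct_add, smul_dotProduct, dotProduct_smul, smul_eq_mul,
      sub_dotProduct, dotProduct_sub, he z hz, dotProduct_comm (A *ᵥ z) e, dotProduct_comm y e]
    ring
  ext x
  simp only [restrictedSol, mem_ofPred_eq]
  refine and_congr_right fun hx => forall_congr' fun z => forall_congr' fun hz => ?_
  rw [h x hx, h z hz, add_le_add_iff_right]

theorem exists_unit_orthogonal {m N : ℕ} (A : Matrix (Fin m) (Fin N) ℝ) {T : Finset (Fin N)}
    (hT : T.card < m) : ∃ e : Fin m → ℝ, e ⬝ᵥ e = 1 ∧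
      ∀ z : Fin N → ℝ, (∀ k ∉ T, z k = 0) → e ⬝ᵥ (A *ᵥ z) = 0 := by
  set B : Matrix T (Fin m) ℝ := Matrix.of fun k i => A i k with hB
  obtain ⟨u, hu0, hu⟩ : ∃ u : Fin m → ℝ, u ≠ 0 ∧ B *ᵥ u = 0 := by
    obtain ⟨u, hu, hu0⟩ := Submodule.exists_mem_ne_zero_of_ne_bot
      (LinearMap.ker_ne_bot_of_finrank_lt (f := B.mulVecLin) (by simpa using hT))
    exact ⟨u, hu0, by simpa using hu⟩
  have hpos : 0 < euc u := (euc_nonneg u).lt_of_ne' (mt euc_eq_zero.1 hu0)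
  refine ⟨(euc u)⁻¹ • u, ?_, fun z hz => ?_⟩
  · rw [smul_dotProduct, dotProduct_smul, ← euc_sq_eq_dotProduct]
    simp only [smul_eq_mul]
    field_simp
  · rw [smul_dotProduct]
    have : u ⬝ᵥ (A *ᵥ z) = 0 := by
      rw [dotProduct_mulVec, dotProduct]
      refine Finset.sum_eq_zero fun k _ => ?_
      by_cases hk : k ∈ T
      · have h1 := congrFun hu ⟨k, hk⟩
        have h2 : (u ᵥ* A) k = (B *ᵥ u) ⟨k, hk⟩ := by
          simp [vecMul, mulVec, hB, dotProduct, mul_comm]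
        rw [h2, h1, Pi.zero_apply, zero_mul]
      · rw [hz k hk, mul_zero]
    rw [this, smul_zero]

theorem stdG_gap_violation {m N : ℕ} {lam : ℝ} (hlam : 0 < lam) (v : Fin N → ℝ)
    {T : Finset (Fin N)} (hT : T.card < m) {j : Fin N} (hj : j ∉ T) (hv : v j ≠ 0) {r : ℝ}
    (hr : 0 ≤ r) (ρ : Measure (Fin m → ℝ)) [IsProbabilityMeasure ρ] :
    ((stdG (Fin m × Fin N)).prod ρ) {p | ∃ x ∈ restrictedSol lam (obs v p) (toMat p.1) T,
      |(|resCorr (obs v p) (toMat p.1) x j| - lam / 2)| ≤ r} ≤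
      ENNReal.ofReal (4 * √(2 * (r / |v j|))) := by
  have hmeas : MeasurableSet {p : (Fin m × Fin N → ℝ) × (Fin m → ℝ) |
      ∃ x ∈ restrictedSol lam (obs v p) (toMat p.1) T,
      |(|resCorr (obs v p) (toMat p.1) x j| - lam / 2)| ≤ r} := by
    refine measurableSet_exists_of_isClosed (C := {q | q.2 ∈ restrictedSol lam (obs v q.1)
      (toMat q.1.1) T ∧ |(|resCorr (obs v q.1) (toMat q.1.1) q.2 j| - lam / 2)| ≤ r}) ?_
    have h4 := continuous_resCorr_obs (m := m) v j
    exact (isClosed_mem_restrictedSol lam v T).inter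
      (isClosed_le (h4.abs.sub continuous_const).abs continuous_const)
  refine stdG_prod_le_of_setCol ρ j hmeas fun X w => ?_
  set A₀ := toMat (setCol j X 0) with hA₀
  obtain ⟨e, he1, heT⟩ := exists_unit_orthogonal A₀ hT
  have hmeas' : MeasurableSet {c | (setCol j X c, w) ∈ {p : (Fin m × Fin N → ℝ) × (Fin m → ℝ) |
      ∃ x ∈ restrictedSol lam (obs v p) (toMat p.1) T,
      |(|resCorr (obs v p) (toMat p.1) x j| - lam / 2)| ≤ r}} := by
    have : Measurable fun c : Fin m → ℝ => (setCol j X c, w) :=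
      ((measurable_setCol j).comp measurable_prodMk_left).prodMk measurable_const
    exact this hmeas
  refine stdG_le_of_direction e he1 hmeas' fun c => ?_
  set c₀ := c - (e ⬝ᵥ c) • e with hc₀
  set y₀ := A₀ *ᵥ v + w + v j • c₀ with hy₀
  obtain ⟨x₀, hx₀⟩ := restrictedSol_nonempty hlam y₀ A₀ T
  set b := (y₀ - A₀ *ᵥ x₀) ⬝ᵥ e + v j * (e ⬝ᵥ c₀) with hb
  set d := (y₀ - A₀ *ᵥ x₀) ⬝ᵥ c₀ with hd
  have hsub : {t : ℝ | c₀ + t • e ∈ {c | (setCol j X c, w) ∈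
      {p : (Fin m × Fin N → ℝ) × (Fin m → ℝ) |
      ∃ x ∈ restrictedSol lam (obs v p) (toMat p.1) T,
      |(|resCorr (obs v p) (toMat p.1) x j| - lam / 2)| ≤ r}}} ⊆
      {t | |v j * t ^ 2 + b * t + (d - lam / 2)| ≤ r} ∪
      {t | |v j * t ^ 2 + b * t + (d + lam / 2)| ≤ r} := by
    intro t ht
    simp only [mem_ofPred_eq] at ht
    obtain ⟨x, hx, h⟩ := ht
    have hobs : obs v (setCol j X (c₀ + t • e), w) = y₀ + (t * v j) • e := by
      rw [obs, toMat_setCol_mulVec, ← hA₀, hy₀]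
      simp only [smul_add, smul_smul, mul_comm t]
      abel
    rw [hobs, restrictedSol_setCol _ _ hj, ← hA₀, restrictedSol_add_smul lam y₀ e A₀ heT] at hx
    rw [hobs, resCorr_setCol _ _ _ (hx.1 j hj), ← hA₀,
      mulVec_eq_of_mem_restrictedSol hlam.le hx hx₀] at h
    have h1 : (y₀ + (t * v j) • e - A₀ *ᵥ x₀) ⬝ᵥ (c₀ + t • e) = v j * t ^ 2 + b * t + d := by
      have : y₀ + (t * v j) • e - A₀ *ᵥ x₀ = (y₀ - A₀ *ᵥ x₀) + (t * v j) • e := by abel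
      rw [this, add_dotProduct, dotProduct_add, dotProduct_add, dotProduct_smul, dotProduct_smul,
        smul_dotProduct, smul_dotProduct, he1, hb, hd]
      simp only [smul_eq_mul]
      ring
    rw [h1] at h
    simp only [mem_union, mem_ofPred_eq]
    rcases abs_cases (v j * t ^ 2 + b * t + d) with ⟨h2, _⟩ | ⟨h2, _⟩
    · left
      rw [h2] at h
      rwa [← add_sub_assoc]
    · right
      rw [h2, abs_sub_comm] at h
      convert h using 2
      ring
  refine (measure_mono hsub).trans ((measure_union_le _ _).trans ((add_le_add
    (gaussianReal_quadratic_le hv _ _ hr) (gaussianReal_quadratic_le hv _ _ hr)).trans_eq ?_))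
  rw [← ENNReal.ofReal_add (by positivity) (by positivity)]
  congr 1
  ring

theorem residual_sq_le {m N : ℕ} {lam : ℝ} (hlam : 0 < lam) (hm : 0 < m) {S : Finset (Fin N)}
    {A : Matrix (Fin m) (Fin N) ℝ}
    (hA : ∀ z : Fin N → ℝ, (∀ j ∉ S, z j = 0) → (m : ℝ) / 3 * euc z ^ 2 ≤ euc (A *ᵥ z) ^ 2)
    {v : Fin N → ℝ} (hv : ∀ j ∉ S, v j = 0) (w : Fin m → ℝ) {x : Fin N → ℝ}
    (hx : x ∈ restrictedSol lam (A *ᵥ v + w) A S) :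
    euc (A *ᵥ v + w - A *ᵥ x) ^ 2 ≤ euc w ^ 2 + 3 * lam ^ 2 / 4 * (S.card / m) := by
  have hm' : (0 : ℝ) < m := Nat.cast_pos.2 hm
  set r := A *ᵥ v + w - A *ᵥ x with hr
  set h := v - x with hh
  have hhS : ∀ j ∉ S, h j = 0 := fun j hj => by rw [hh, Pi.sub_apply, hv j hj, hx.1 j hj, sub_zero]
  set u := A *ᵥ h with hu
  have hw : w = r - u := by
    rw [hr, hu, hh, mulVec_sub]
    abel
  have h1 : r ⬝ᵥ u ≤ lam / 2 * ∑ j ∈ S, |h j| := by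
    rw [hu, dotProduct_mulVec, dotProduct, Finset.mul_sum,
      ← Finset.sum_subset (Finset.subset_univ S) fun j _ hj => by rw [hhS j hj, mul_zero]]
    refine Finset.sum_le_sum fun j hj => ?_
    refine (le_abs_self _).trans ?_
    rw [abs_mul]
    exact mul_le_mul_of_nonneg_right (abs_resCorr_le hlam.le hx hj) (abs_nonneg _)
  have h2 : (∑ j ∈ S, |h j|) ^ 2 ≤ S.card * euc h ^ 2 := by
    refine (sq_sum_le_card_mul_sum_sq (s := S) (f := fun j => |h j|)).trans ?_
    refine mul_le_mul_of_nonneg_left ?_ (Nat.cast_nonneg _)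
    rw [euc_sq]
    simp only [sq_abs]
    exact Finset.sum_le_sum_of_subset_of_nonneg (Finset.subset_univ S) fun j _ _ => sq_nonneg _
  have h3 := hA h hhS
  have h4 : euc w ^ 2 = euc r ^ 2 - 2 * (r ⬝ᵥ u) + euc u ^ 2 := by
    rw [hw]
    simp only [euc_sq_eq_dotProduct, sub_dotProduct, dotProduct_sub, dotProduct_comm u r]
    ring
  set l := ∑ j ∈ S, |h j| with hl
  have hl0 : 0 ≤ l := Finset.sum_nonneg fun j _ => abs_nonneg _
  have h5 : euc h ^ 2 ≤ 3 / m * euc u ^ 2 := by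
    rw [div_mul_eq_mul_div, le_div_iff₀ hm']
    linarith
  have h6 : (lam * l) ^ 2 ≤ 4 * (3 * lam ^ 2 / 4 * (S.card / m)) * euc u ^ 2 := by
    calc (lam * l) ^ 2 = lam ^ 2 * l ^ 2 := by ring
      _ ≤ lam ^ 2 * (S.card * (3 / m * euc u ^ 2)) := by
        refine mul_le_mul_of_nonneg_left (h2.trans ?_) (sq_nonneg _)
        exact mul_le_mul_of_nonneg_left h5 (Nat.cast_nonneg _)
      _ = _ := by ring
  set K := 3 * lam ^ 2 / 4 * (S.card / m : ℝ) with hK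
  have hK0 : 0 ≤ K := mul_nonneg (by linarith [sq_nonneg lam])
    (div_nonneg (Nat.cast_nonneg _) hm'.le)
  have h7 : lam * l ≤ K + euc u ^ 2 := by
    refine le_of_sq_le_sq ?_ (add_nonneg hK0 (sq_nonneg _))
    nlinarith [sq_nonneg (K - euc u ^ 2)]
  linarith

theorem pi_gaussianReal_eq_map (m : ℕ) (η : ℝ≥0) :
    (Measure.pi fun _ : Fin m => gaussianReal 0 (η ^ 2)) =
      (stdG (Fin m)).map fun x i => (η : ℝ) * x i := by
  have h : gaussianReal 0 (η ^ 2) = (gaussianReal 0 1).map ((η : ℝ) * ·) := by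
    rw [gaussianReal_map_const_mul, mul_zero, mul_one]
    congr 1
  rw [h]
  exact (Measure.pi_map_pi fun _ => by fun_prop).symm

theorem pi_gaussianReal_euc_large (m : ℕ) (η : ℝ≥0) :
    (Measure.pi fun _ : Fin m => gaussianReal 0 (η ^ 2)) {w | 2 * m * (η : ℝ) ^ 2 < euc w ^ 2} ≤
      ENNReal.ofReal (exp (-(m / 24))) := by
  have hmeas : MeasurableSet {w : Fin m → ℝ | 2 * m * (η : ℝ) ^ 2 < euc w ^ 2} :=
    (isOpen_lt continuous_const (continuous_euc.pow 2)).measurableSet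
  rw [pi_gaussianReal_eq_map, Measure.map_apply (by fun_prop) hmeas]
  refine (measure_mono fun g hg => ?_).trans (stdG_euc_large m)
  simp only [mem_preimage, mem_ofPred_eq] at hg ⊢
  have : euc (fun i => (η : ℝ) * g i) ^ 2 = (η : ℝ) ^ 2 * euc g ^ 2 := by
    simp only [euc_sq, mul_pow, Finset.mul_sum]
  rw [this, mul_comm _ ((η : ℝ) ^ 2)] at hg
  exact lt_of_mul_lt_mul_left hg (sq_nonneg _)

theorem gap_probability_le {m N : ℕ} (hm : 1 ≤ m) (hN : 1 ≤ N) {lam α σ a : ℝ} (hlam : 0 < lam)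
    (hα : 3 * √(m : ℝ) + 6 * √(N : ℝ) ≤ α) (hσ : 0 < σ) (hσm : σ ≤ 1 / (4 * (m : ℝ) ^ 2))
    (hσlam : σ ≤ lam / 4) (ha : lam / (2 * m) ≤ a) :
    4 * √(2 * (σ ^ 2 / (2 * α ^ 3) / a)) ≤ 2 * exp (-(1 / 4) * log N) / m := by
  have hm' : (0 : ℝ) < m := by exact_mod_cast hm
  have hN' : (0 : ℝ) < N := by exact_mod_cast hN
  have hsm := Real.sqrt_pos.2 hm'
  have hsN := Real.sqrt_pos.2 hN'
  have hα0 : 0 < α := by linarith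
  have ha0 : 0 < a := lt_of_lt_of_le (by positivity) ha
  have hα3 : m * √(N : ℝ) ≤ α ^ 3 := by
    have h1 : √(m : ℝ) ^ 2 ≤ α ^ 2 := pow_le_pow_left₀ hsm.le (by linarith) 2
    rw [Real.sq_sqrt hm'.le] at h1
    calc m * √(N : ℝ) ≤ α ^ 2 * α := mul_le_mul h1 (by linarith) hsN.le (by positivity)
      _ = _ := by ring
  have hσ2 : σ ^ 2 ≤ lam / (16 * m ^ 2) := by
    calc σ ^ 2 = σ * σ := sq σ
      _ ≤ lam / 4 * (1 / (4 * (m : ℝ) ^ 2)) := mul_le_mul hσlam hσm hσ.le (by positivity)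
      _ = _ := by field_simp; norm_num
  have h1 : 2 * (σ ^ 2 / (2 * α ^ 3) / a) ≤ 1 / (4 * m ^ 2 * √(N : ℝ)) := by
    have h2 : 2 * (σ ^ 2 / (2 * α ^ 3) / a) = σ ^ 2 / (α ^ 3 * a) := by field_simp
    rw [h2]
    calc σ ^ 2 / (α ^ 3 * a) ≤ (lam / (16 * m ^ 2)) / ((m * √(N : ℝ)) * (lam / (2 * m))) := by
          gcongr
      _ = 1 / (8 * m ^ 2 * √(N : ℝ)) := by
          field_simp
          norm_num
      _ ≤ _ := by
          gcongr
          norm_num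
  have h3 : exp (-(1 / 4) * log N) ^ 2 = 1 / √(N : ℝ) := by
    have h4 : 1 / √(N : ℝ) = exp (-(log N / 2)) := by
      rw [exp_neg, ← Real.log_sqrt hN'.le, Real.exp_log hsN, one_div]
    rw [← exp_nat_mul, h4]
    congr 1
    push_cast
    ring
  have h4 : √(2 * (σ ^ 2 / (2 * α ^ 3) / a)) ≤ exp (-(1 / 4) * log N) / (2 * m) := by
    refine (Real.sqrt_le_left (by positivity)).2 (h1.trans_eq ?_)
    rw [div_pow, h3]
    field_simp
    norm_num
  calc _ ≤ 4 * (exp (-(1 / 4) * log N) / (2 * m)) := by gcongr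
    _ = _ := by
      field_simp
      norm_num

theorem dual_probability_eq {L lam : ℝ} (hL : 0 < L) (hlam : 0 < lam) :
    -(7 * lam / 16) ^ 2 / (2 * (lam ^ 2 / (16 * L))) = -(49 / 32) * L := by
  field_simp
  norm_num

theorem prod_condUL_large_le {m N : ℕ} {lam : ℝ} (hlam : 0 < lam) (η : ℝ≥0) {v : Fin N → ℝ}
    {S : Finset (Fin N)} (hvS : ∀ j ∉ S, v j = 0) (hs : 1 ≤ S.card) (hm : 256 * S.card ≤ m)
    (hN : S.card + 2 ≤ N)
    (hnoise : 2 * m * (η : ℝ) ^ 2 + 3 * lam ^ 2 / 4 * (S.card / m) ≤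
      lam ^ 2 / (16 * log (N - S.card)))
    {α σ : ℝ} (hα : 3 * √(m : ℝ) + 6 * √(N : ℝ) ≤ α)
    (hαv : 5 / 2 * √(m : ℝ) * (η + euc v) ≤ α) (hσ : 0 < σ) (hσm : σ ≤ 1 / (4 * (m : ℝ) ^ 2))
    (hσlam : σ ≤ lam / 4) (hvj : ∀ j ∈ S, lam / (2 * m) ≤ |v j|) :
    ((stdG (Fin m × Fin N)).prod (Measure.pi fun _ : Fin m => gaussianReal 0 (η ^ 2)))
      {p | ENNReal.ofReal (√(m * N) * max (qpoly N lam α σ / σ ^ 2) (max (6 * α / √σ) 1)) ≤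
        condUL lam (obs v p) (toMat p.1)} ≤
      ENNReal.ofReal (9 * exp (-(1 / 4) * min (log (N - S.card)) S.card)) := by
  have hm1 : 1 ≤ m := by omega
  have hN1 : 1 ≤ N := by omega
  have hm' : (1 : ℝ) ≤ m := by exact_mod_cast hm1
  set ρ : Measure (Fin m → ℝ) := Measure.pi fun _ : Fin m => gaussianReal 0 (η ^ 2) with hρ
  set L := log ((N : ℝ) - S.card) with hLdef
  have hNs : (2 : ℝ) ≤ N - S.card := by
    have : ((S.card + 2 : ℕ) : ℝ) ≤ N := by exact_mod_cast hN
    push_cast at this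
    linarith
  have hL : 0 < L := Real.log_pos (by linarith)
  set V := lam ^ 2 / (16 * L) with hV
  have hV0 : 0 < V := by positivity
  set r := σ ^ 2 / (2 * α ^ 3) with hr
  have hα0 : 0 < α := lt_of_lt_of_le (by positivity) hα
  have hr0 : 0 ≤ r := by positivity
  set q := 1 / 4 * min L S.card with hq
  have hqL : q ≤ 1 / 4 * L := by
    have := min_le_left L (S.card : ℝ)
    linarith
  have hqs : q ≤ 1 / 4 * S.card := by
    have := min_le_right L (S.card : ℝ)
    linarith
  have hsR : (1 : ℝ) ≤ S.card := by exact_mod_cast hs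
  have hmR : 256 * (S.card : ℝ) ≤ m := by exact_mod_cast hm
  set E1 : Set (Fin m × Fin N → ℝ) := {X | ¬ ∀ z : Fin N → ℝ, (∀ j ∉ S, z j = 0) →
      (m : ℝ) / 3 * euc z ^ 2 ≤ euc (toMat X *ᵥ z) ^ 2} with hE1
  set E2 : Set (Fin m × Fin N → ℝ) :=
    {X | ∃ j, 3 * √(m : ℝ) + 6 * √(N : ℝ) < euc fun i => toMat X i j} with hE2
  set E3 : Set (Fin m × Fin N → ℝ) := {X | 5 / 2 * √(m : ℝ) * euc v < euc (toMat X *ᵥ v)} with hE3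
  set E4 : Set (Fin m → ℝ) := {w | 2 * m * (η : ℝ) ^ 2 < euc w ^ 2} with hE4
  set E5 : Fin N → Set ((Fin m × Fin N → ℝ) × (Fin m → ℝ)) := fun j =>
    {p | ∃ x ∈ restrictedSol lam (obs v p) (toMat p.1) S,
      euc (obs v p - toMat p.1 *ᵥ x) ^ 2 ≤ V ∧
        7 * lam / 16 ≤ |resCorr (obs v p) (toMat p.1) x j|} with hE5
  set E6 : Fin N → Set ((Fin m × Fin N → ℝ) × (Fin m → ℝ)) := fun j =>
    {p | ∃ x ∈ restrictedSol lam (obs v p) (toMat p.1) (S.erase j),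
      |(|resCorr (obs v p) (toMat p.1) x j| - lam / 2)| ≤ r} with hE6
  have hsub : {p : (Fin m × Fin N → ℝ) × (Fin m → ℝ) |
      ENNReal.ofReal (√(m * N) * max (qpoly N lam α σ / σ ^ 2) (max (6 * α / √σ) 1)) ≤
        condUL lam (obs v p) (toMat p.1)} ⊆
      ((E1 ∪ E2 ∪ E3) ×ˢ univ) ∪ (univ ×ˢ E4) ∪ (⋃ j ∈ Sᶜ, E5 j) ∪ ⋃ j ∈ S, E6 j := by
    intro p hp
    by_contra hcon
    simp only [mem_union, mem_prod, mem_univ, and_true, true_and, mem_iUnion, not_or,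
      not_exists] at hcon
    obtain ⟨⟨⟨⟨⟨h1, h2⟩, h3⟩, h4⟩, h5⟩, h6⟩ := hcon
    simp only [hE1, mem_ofPred_eq, not_not] at h1
    simp only [hE2, mem_ofPred_eq, not_exists, not_lt] at h2
    simp only [hE3, mem_ofPred_eq, not_lt] at h3
    simp only [hE4, mem_ofPred_eq, not_lt] at h4
    have hw : euc p.2 ≤ 5 / 2 * √(m : ℝ) * η := by
      refine le_of_sq_le_sq (h4.trans ?_) (by positivity)
      rw [mul_pow, mul_pow, Real.sq_sqrt (Nat.cast_nonneg m)]
      refine mul_le_mul_of_nonneg_right ?_ (sq_nonneg _)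
      linarith
    refine not_le.2 (condUL_lt_of_stable (S := S) (y := obs v p) (A := toMat p.1) hlam hm1 hN1 ?_ hσ
      ?_ hσlam h1 (fun j => (h2 j).trans hα) ?_ ?_ ?_) hp
    · have := Real.sqrt_nonneg (N : ℝ)
      linarith
    · refine hσm.trans (one_div_le_one_div_of_le (by norm_num) ?_)
      nlinarith
    · refine (euc_add_le _ _).trans ?_
      linarith
    · intro x hx j hj
      by_contra! hge
      refine h5 j (Finset.mem_compl.2 hj) ⟨x, hx, ?_, hge⟩
      have := residual_sq_le hlam hm1 h1 hvS p.2 hx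
      exact this.trans (by linarith)
    · intro j hj x hx
      by_contra! hle
      exact h6 j hj ⟨x, hx, hle⟩
  refine (measure_mono hsub).trans ?_
  have b1 : ((stdG (Fin m × Fin N)).prod ρ) ((E1 ∪ E2 ∪ E3) ×ˢ univ) ≤
      ENNReal.ofReal (4 * exp (-q)) := by
    rw [Measure.prod_prod, measure_univ, mul_one]
    refine ((measure_union_le _ _).trans (add_le_add_left (measure_union_le _ _) _)).trans ?_
    refine (add_le_add (add_le_add (stdG_not_restricted_lower S hm) stdG_column_large)
      (stdG_mulVec_large v)).trans ?_
    rw [← ENNReal.ofReal_add (by positivity) (by positivity),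
      ← ENNReal.ofReal_add (by positivity) (by positivity)]
    refine ENNReal.ofReal_le_ofReal ?_
    have e1 : exp (-(S.card : ℝ)) ≤ exp (-q) := exp_le_exp.2 (by linarith)
    have e2 : exp (-(m : ℝ)) ≤ exp (-q) := exp_le_exp.2 (by linarith)
    linarith
  have b2 : ((stdG (Fin m × Fin N)).prod ρ) (univ ×ˢ E4) ≤ ENNReal.ofReal (exp (-q)) := by
    rw [Measure.prod_prod, measure_univ, one_mul]
    exact (pi_gaussianReal_euc_large m η).trans
      (ENNReal.ofReal_le_ofReal (exp_le_exp.2 (by linarith)))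
  have b3 : ((stdG (Fin m × Fin N)).prod ρ) (⋃ j ∈ Sᶜ, E5 j) ≤ ENNReal.ofReal (2 * exp (-q)) := by
    refine (measure_biUnion_finset_le _ _).trans ((Finset.sum_le_sum fun j hj =>
      stdG_dual_violation hlam v S (Finset.mem_compl.1 hj) (hvS j (Finset.mem_compl.1 hj)) hV0
        ρ).trans ?_)
    rw [Finset.sum_const, nsmul_eq_mul, ← ENNReal.ofReal_natCast,
      ← ENNReal.ofReal_mul (Nat.cast_nonneg _)]
    refine ENNReal.ofReal_le_ofReal ?_
    have hc : ((Sᶜ.card : ℕ) : ℝ) = exp L := by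
      rw [Finset.card_compl, Fintype.card_fin, Nat.cast_sub (by omega), hLdef,
        Real.exp_log (by linarith)]
    rw [hc, dual_probability_eq hL hlam, mul_left_comm, ← exp_add]
    refine mul_le_mul_of_nonneg_left (exp_le_exp.2 ?_) (by norm_num)
    linarith
  have b4 : ((stdG (Fin m × Fin N)).prod ρ) (⋃ j ∈ S, E6 j) ≤ ENNReal.ofReal (2 * exp (-q)) := by
    have hone : ∀ j ∈ S, ((stdG (Fin m × Fin N)).prod ρ) (E6 j) ≤
        ENNReal.ofReal (2 * exp (-q) / m) := fun j hj => by
      have hv0 : v j ≠ 0 := abs_pos.1 (lt_of_lt_of_le (by positivity) (hvj j hj))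
      have hcard : (S.erase j).card < m := by
        have := Finset.card_erase_le (s := S) (a := j)
        omega
      refine (stdG_gap_violation hlam v hcard (Finset.notMem_erase j S) hv0 hr0 ρ).trans
        (ENNReal.ofReal_le_ofReal
          ((gap_probability_le hm1 hN1 hlam hα hσ hσm hσlam (hvj j hj)).trans ?_))
      have : L ≤ log N := Real.log_le_log (by linarith) (by linarith)
      gcongr
      linarith
    refine (measure_biUnion_finset_le _ _).trans ((Finset.sum_le_sum hone).trans ?_)
    rw [Finset.sum_const, nsmul_eq_mul, ← ENNReal.ofReal_natCast,
      ← ENNReal.ofReal_mul (Nat.cast_nonneg _)]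
    refine ENNReal.ofReal_le_ofReal ?_
    rw [mul_div_assoc', div_le_iff₀ (by linarith)]
    have := exp_pos (-q)
    nlinarith
  have hfin : -(1 / 4) * min L S.card = -q := by
    rw [hq]
    ring
  rw [hfin]
  refine ((measure_union_le _ _).trans (add_le_add ((measure_union_le _ _).trans (add_le_add
    ((measure_union_le _ _).trans (add_le_add b1 b2)) b3)) b4)).trans_eq ?_
  rw [← ENNReal.ofReal_add (by positivity) (by positivity),
    ← ENNReal.ofReal_add (by positivity) (by positivity),
    ← ENNReal.ofReal_add (by positivity) (by positivity)]
  congr 1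
  ring

theorem map_matrix_noise_eq_prod {m N : ℕ} {η : ℝ≥0} {Ω : Type*} [MeasurableSpace Ω]
    {μ : Measure Ω} [IsProbabilityMeasure μ] {A : Ω → Fin m → Fin N → ℝ} (hA : Measurable A)
    (hAi : iIndepFun (fun p : Fin m × Fin N => fun ω => A ω p.1 p.2) μ)
    (hAm : ∀ i j, Measure.map (fun ω => A ω i j) μ = gaussianReal 0 1)
    {w : Ω → Fin m → ℝ} (hw : Measurable w) (hwi : iIndepFun (fun i ω => w ω i) μ)
    (hwm : ∀ i, Measure.map (fun ω => w ω i) μ = gaussianReal 0 (η ^ 2)) (hAw : IndepFun A w μ) :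
    μ.map (fun ω => (fun p : Fin m × Fin N => A ω p.1 p.2, w ω)) =
      (stdG (Fin m × Fin N)).prod (Measure.pi fun _ : Fin m => gaussianReal 0 (η ^ 2)) := by
  have hcurry : Measurable fun B : Fin m → Fin N → ℝ => fun p : Fin m × Fin N => B p.1 p.2 := by
    fun_prop
  have h1 : μ.map (fun ω => fun p : Fin m × Fin N => A ω p.1 p.2) = stdG (Fin m × Fin N) := by
    rw [(iIndepFun_iff_map_fun_eq_pi_map fun p => by fun_prop).1 hAi]
    simp only [hAm]
  have h2 : μ.map w = Measure.pi fun _ : Fin m => gaussianReal 0 (η ^ 2) := by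
    have := (iIndepFun_iff_map_fun_eq_pi_map fun i => by fun_prop).1 hwi
    simpa only [hwm] using this
  have h3 : IndepFun (fun ω => fun p : Fin m × Fin N => A ω p.1 p.2) w μ :=
    hAw.comp hcurry measurable_id
  rw [(indepFun_iff_map_prod_eq_prod_map_map (by fun_prop) hw.aemeasurable).1 h3, h1, h2]

theorem minAbsOn_le {N : ℕ} {v : Fin N → ℝ} {j : Fin N} (hj : v j ≠ 0) : minAbsOn v ≤ |v j| :=
  csInf_le ⟨0, by rintro _ ⟨k, -, rfl⟩; exact abs_nonneg _⟩ ⟨j, hj, rfl⟩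

theorem mem_suppF {N : ℕ} {v : Fin N → ℝ} {j : Fin N} : j ∈ suppF v ↔ v j ≠ 0 := by
  simp [suppF]

theorem noise_le_of_sample_size {m N s : ℕ} {lam η ε : ℝ} (hlam : 0 < lam) (hm : 0 < m)
    (hN : s + 2 ≤ N) (hε : 0 < ε)
    (h : 12 * (s : ℝ) * log ((N : ℝ) - s) <
      m * (1 / (1 + ε) - 6 / (lam ^ 2 / (8 * η ^ 2 * log N * m)))) :
    2 * m * η ^ 2 + 3 * lam ^ 2 / 4 * (s / m) ≤ lam ^ 2 / (16 * log (N - s)) := by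
  have hm' : (0 : ℝ) < m := Nat.cast_pos.2 hm
  have hNs : (2 : ℝ) ≤ N - s := by
    have : ((s + 2 : ℕ) : ℝ) ≤ N := by exact_mod_cast hN
    push_cast at this
    linarith
  set L := log ((N : ℝ) - s) with hLdef
  have hL : 0 < L := Real.log_pos (by linarith)
  have hs0 : (0 : ℝ) ≤ s := Nat.cast_nonneg _
  have hLN : L ≤ log N := Real.log_le_log (by linarith) (by linarith)
  have h1 : 1 / (1 + ε) ≤ 1 := by
    rw [div_le_one (by linarith)]
    linarith
  have h2 : 6 / (lam ^ 2 / (8 * η ^ 2 * log N * m)) = 48 * η ^ 2 * log N * m / lam ^ 2 := by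
    rw [div_div_eq_mul_div]
    ring
  rw [h2] at h
  have h3 : 12 * s * L < m * (1 - 48 * η ^ 2 * L * m / lam ^ 2) := by
    refine h.trans_le (mul_le_mul_of_nonneg_left (sub_le_sub h1 ?_) hm'.le)
    gcongr
  have h4 : 12 * s * L * lam ^ 2 < m * (lam ^ 2 - 48 * η ^ 2 * L * m) := by
    have h5 := mul_lt_mul_of_pos_right h3 (by positivity : 0 < lam ^ 2)
    refine h5.trans_eq ?_
    field_simp
  have h6 : 0 ≤ η ^ 2 * L * m * m := by positivity
  rw [le_div_iff₀ (by positivity)]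
  have h7 : (2 * m * η ^ 2 + 3 * lam ^ 2 / 4 * (s / m)) * (16 * L) =
      (32 * m * m * η ^ 2 * L + 12 * lam ^ 2 * s * L) / m := by
    field_simp
    ring
  rw [h7, div_le_iff₀ hm']
  nlinarith

end

/-- Isotropic case `Σ = I_N`. Under (ai') and (aii') there exist absolute
constants `𝐜₁, 𝐜₂ > 0` (and `c₃` is the universal constant from Wainwright's theorem, entering
`g(λ)`) such that `ℙ(C_UL(y,A) ≥ K̂) ≤ 𝐜₁ e^{−𝐜₂ min{ln(N−s), s}}`, where
`σ̂ = min{1/(4(√s+√m)⁴), λ/4, min_{j∈S}|v_j| − g(λ)}`,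
`α̂ = max{1, (5/2)√m(η + ‖v‖₂), 3√m + 6√N}` and `K̂ = (mN)^{1/2} max{q(α̂,σ̂)/σ̂², 6α̂/√σ̂, 1}`. -/
theorem condition_number_probabilistic_bound_isotropic :
    ∃ c3 c1 c2 : ℝ, 0 < c3 ∧ 0 < c1 ∧ 0 < c2 ∧
      ∀ (m N : ℕ) (lam : ℝ), 0 < lam →
      ∀ (η : ℝ≥0) (v : Fin N → ℝ)
        (Ω : Type) [MeasurableSpace Ω] (μ : Measure Ω) [IsProbabilityMeasure μ]
        (A : Ω → Fin m → Fin N → ℝ), Measurable A →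
        -- the entries of `A` are i.i.d. standard Gaussian
        iIndepFun
          (fun p : Fin m × Fin N => fun ω => A ω p.1 p.2) μ →
        (∀ i j, Measure.map (fun ω => A ω i j) μ = gaussianReal 0 1) →
      ∀ (w : Ω → Fin m → ℝ), Measurable w →
        iIndepFun (fun i ω => w ω i) μ →
        (∀ i, Measure.map (fun ω => w ω i) μ = gaussianReal 0 (η ^ 2)) →
        IndepFun A w μ →
      ∀ (y : Ω → Fin m → ℝ), (∀ ω, y ω = (Matrix.of (A ω)).mulVec v + w ω) →
      -- `g(λ)` and `φ_N` in the isotropic case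
      ∀ g phiN : ℝ,
        g = c3 * lam / (2 * (m : ℝ)) +
              20 * Real.sqrt ((η : ℝ) ^ 2 * Real.log ((suppF v).card : ℝ) / (m : ℝ)) →
        phiN = lam ^ 2 / (8 * (η : ℝ) ^ 2 * Real.log (N : ℝ) * (m : ℝ)) →
      -- (ai')
      ∀ ε : ℝ, 0 < ε → ε < 1 / 2 →
        8 * Real.sqrt ((suppF v).card / (m : ℝ)) < ε →
        12 * ((suppF v).card : ℝ) * Real.log ((N : ℝ) - (suppF v).card)
          < (m : ℝ) * (1 / (1 + ε) - 6 / phiN) →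
      -- (aii')
      g < minAbsOn v →
      -- `σ̂` and `α̂`
      ∀ sigHat alphaHat : ℝ,
        sigHat = min (1 / (4 * (Real.sqrt ((suppF v).card : ℝ) + Real.sqrt (m : ℝ)) ^ 4))
            (min (lam / 4) (minAbsOn v - g)) →
        alphaHat = max 1
            (max ((5 / 2) * Real.sqrt (m : ℝ) * ((η : ℝ) + l2norm v))
              (3 * Real.sqrt (m : ℝ) + 6 * Real.sqrt (N : ℝ))) →
        μ {ω | ENNReal.ofReal
              (Real.sqrt ((m : ℝ) * N) *
                max (qpoly N lam alphaHat sigHat / sigHat ^ 2)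
                  (max (6 * alphaHat / Real.sqrt sigHat) 1))
            ≤ condUL lam (y ω) (Matrix.of (A ω))}
          ≤ ENNReal.ofReal
            (c1 * Real.exp (-c2 * min (Real.log ((N : ℝ) - (suppF v).card))
                ((suppF v).card : ℝ))) := by
  refine ⟨1, 9, 1 / 4, one_pos, by norm_num, by norm_num, ?_⟩
  intro m N lam hlam η v Ω _ μ _ A hA hAi hAm w hw hwi hwm hAw y hy g phiN hg hphi ε hε hε2 hεs
    hsize hgv σ α hσ hα
  subst hphi
  set S := suppF v with hS
  by_cases hbig : 1 ≤ S.card ∧ S.card + 2 ≤ N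
  · obtain ⟨hs, hN⟩ := hbig
    have hsR : (1 : ℝ) ≤ S.card := by exact_mod_cast hs
    have hNs : (2 : ℝ) ≤ N - S.card := by
      have : ((S.card + 2 : ℕ) : ℝ) ≤ N := by exact_mod_cast hN
      push_cast at this
      linarith
    have hm : 0 < m := by
      by_contra! h0
      obtain rfl : m = 0 := by omega
      have hL : 0 < log ((N : ℝ) - S.card) := Real.log_pos (by linarith)
      rw [Nat.cast_zero, zero_mul] at hsize
      have : 0 < 12 * (S.card : ℝ) * log ((N : ℝ) - S.card) := by positivity
      linarith
    have hm1 : (1 : ℝ) ≤ m := by exact_mod_cast hm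
    have hms : 256 * S.card ≤ m := by
      have h1 : √((S.card : ℝ) / m) < 1 / 16 := by linarith
      rw [Real.sqrt_lt' (by norm_num), div_lt_iff₀ (by linarith)] at h1
      have : (256 * S.card : ℝ) ≤ m := by linarith
      exact_mod_cast this
    have hnoise := noise_le_of_sample_size hlam hm hN hε hsize
    have hgl : lam / (2 * m) ≤ g := by
      rw [hg, one_mul]
      have : 0 ≤ 20 * √((η : ℝ) ^ 2 * log (S.card : ℝ) / m) := by positivity
      linarith
    have hl2 : l2norm v = euc v := (euc_eq_sqrt v).symm
    have hpos : 0 < √(S.card : ℝ) + √(m : ℝ) := by positivity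
    have hσ0 : 0 < σ := by
      rw [hσ]
      exact lt_min (by positivity) (lt_min (by positivity) (sub_pos.2 hgv))
    have hσm : σ ≤ 1 / (4 * (m : ℝ) ^ 2) := by
      rw [hσ]
      refine (min_le_left _ _).trans (one_div_le_one_div_of_le (by positivity) ?_)
      have h1 : √(m : ℝ) ^ 4 ≤ (√(S.card : ℝ) + √(m : ℝ)) ^ 4 :=
        pow_le_pow_left₀ (Real.sqrt_nonneg _) (by linarith [Real.sqrt_nonneg (S.card : ℝ)]) 4
      have h2 : √(m : ℝ) ^ 4 = (m : ℝ) ^ 2 := by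
        rw [show 4 = 2 * 2 from rfl, pow_mul, Real.sq_sqrt (Nat.cast_nonneg m)]
      linarith
    have hσlam : σ ≤ lam / 4 := by
      rw [hσ]
      exact (min_le_right _ _).trans (min_le_left _ _)
    have hprod := prod_condUL_large_le hlam η (v := v) (S := S)
      (fun j hj => by_contra fun h => hj (mem_suppF.2 h)) hs hms hN hnoise
      (α := α) (σ := σ) (hα ▸ (le_max_right _ _).trans (le_max_right _ _))
      (hα ▸ hl2 ▸ (le_max_left _ _).trans (le_max_right _ _)) hσ0 hσm hσlam
      fun j hj => hgl.trans (hgv.le.trans (minAbsOn_le (mem_suppF.1 hj)))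
    rw [← map_matrix_noise_eq_prod hA hAi hAm hw hwi hwm hAw] at hprod
    refine le_trans ?_ ((Measure.le_map_apply (by fun_prop) _).trans hprod)
    refine measure_mono fun ω hω => ?_
    rw [mem_ofPred_eq, hy ω] at hω
    exact hω
  · have hmin : min (log ((N : ℝ) - S.card)) (S.card : ℝ) ≤ 0 := by
      by_cases hs : 1 ≤ S.card
      · refine (min_le_left _ _).trans ?_
        have h1 : S.card ≤ N := by simpa using Finset.card_le_univ S
        have h2 : N < S.card + 2 := by
          by_contra! h
          exact hbig ⟨hs, h⟩
        have h3 : (S.card : ℝ) ≤ N := by exact_mod_cast h1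
        have h4 : (N : ℝ) ≤ S.card + 1 := by exact_mod_cast Nat.lt_succ_iff.1 h2
        exact Real.log_nonpos (by linarith) (by linarith)
      · have h1 : S.card = 0 := by omega
        rw [h1, Nat.cast_zero]
        exact min_le_right _ _
    refine prob_le_one.trans ?_
    rw [← ENNReal.ofReal_one]
    refine ENNReal.ofReal_le_ofReal ?_
    have : 1 ≤ exp (-(1 / 4) * min (log ((N : ℝ) - S.card)) (S.card : ℝ)) :=
      Real.one_le_exp (by linarith)
    linarith
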